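/- Let α₁, …, α₇ ∈ ℂ be distinct. There exists ε > 0, depending only on α₁, …, α₇, with the following property: if Ω ⊆ ℂ is a nonempty open simply connected set, h, g : Ω → ℂ are holomorphic with no common zero, the conformal metric (|h(z)|² + |g(z)|²)|dz|² on Ω is complete, and the meromorphic function ρ = g/h has no simple island over any of the disks D(α_j, ε) = {w ∈ ℂ : |w − α_j| < ε} (j = 1, …, 7), then ρ is constant, i.e. there exist (a, b) ∈ ℂ² ∖ {(0,0)} with a·g + b·h ≡ 0 on Ω. (This is the analytic content of the paper's analogue, for the ratio of canonical forms of a weakly complete flat front in H³, of the Ahlfors Five Islands Theorem: if ρ has no simple island over any of seven small disks, the front is a horosphere or a hyperbolic cylinder.) -/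

import Mathlib

open MeasureTheory

/-- A path `γ : [0,1) → ℂ` is *divergent* in an open set `U ⊆ ℂ`: it eventually
leaves every compact subset of `U`. -/
def DivergentPath (U : Set ℂ) (γ : ℝ → ℂ) : Prop :=
  ∀ K : Set ℂ, K ⊆ U → IsCompact K →
    ∃ t₀ ∈ Set.Ico (0 : ℝ) 1, ∀ t, t₀ < t → t < 1 → γ t ∉ K

/-- `γ : [0,1) → ℂ` is continuous and piecewise continuously differentiable,
with derivative `γ'` away from a locally finite set of exceptional points. -/
def PiecewiseC1 (γ γ' : ℝ → ℂ) : Prop :=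
  ContinuousOn γ (Set.Ico 0 1) ∧
  ∃ D : Set ℝ, (∀ b : ℝ, b < 1 → (D ∩ Set.Icc 0 b).Finite) ∧
    (∀ t ∈ Set.Ico (0 : ℝ) 1 \ D, HasDerivAt γ (γ' t) t) ∧
    ContinuousOn γ' (Set.Ico 0 1 \ D)

/-- The conformal metric `lam(z)² |dz|²` on `U` is *complete*: every divergent
piecewise C¹ path in `U` has infinite length. -/
def MetricComplete (U : Set ℂ) (lam : ℂ → ℝ) : Prop :=
  ∀ γ γ' : ℝ → ℂ, (∀ t ∈ Set.Ico (0 : ℝ) 1, γ t ∈ U) →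
    PiecewiseC1 γ γ' → DivergentPath U γ →
    ∫⁻ t in Set.Ico (0 : ℝ) 1, ENNReal.ofReal (lam (γ t) * ‖γ' t‖) = ⊤

/-- `W` is an *island* of the meromorphic function `ρ = g/h` over the Jordan
domain `V ⊆ ℂ`: a simply connected connected component of `ρ⁻¹(V)` whose
closure is a compact subset of `Ω`.  (The preimage is taken among points of
`Ω` that are not poles of `ρ`, i.e. where `h ≠ 0`.) -/
def IsIsland (Ω : Set ℂ) (h g : ℂ → ℂ) (V W : Set ℂ) : Prop :=
  (∃ z ∈ {w ∈ Ω | h w ≠ 0 ∧ g w / h w ∈ V},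
      W = connectedComponentIn {w ∈ Ω | h w ≠ 0 ∧ g w / h w ∈ V} z) ∧
  SimplyConnectedSpace ↥W ∧ IsCompact (closure W) ∧ closure W ⊆ Ω



namespace Isl
open Set Metric Filter Topology

/-- Continuous convergence of a family of functions on a set. -/
def CC (U : Filter ℕ) (f : ℕ → ℂ → ℂ) (F : ℂ → ℂ) (s : Set ℂ) : Prop :=
  ∀ w ∈ s, Tendsto (fun p : ℕ × ℂ => f p.1 p.2) (U ×ˢ 𝓝 w) (𝓝 (F w))

theorem CC_of_tlu {U : Filter ℕ} {f : ℕ → ℂ → ℂ} {F : ℂ → ℂ} {s : Set ℂ} (hs : IsOpen s)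
    (hF : ContinuousOn F s) (h : TendstoLocallyUniformlyOn f F U s) : CC U f F s := by
  intro w hw
  rw [tendstoLocallyUniformlyOn_iff_forall_tendsto] at h
  have h1 := h w hw
  rw [hs.nhdsWithin_eq hw] at h1
  have h2 : Tendsto (fun p : ℕ × ℂ => F p.2) (U ×ˢ 𝓝 w) (𝓝 (F w)) :=
    (hF.continuousAt (hs.mem_nhds hw)).tendsto.comp tendsto_snd
  exact h2.congr_uniformity h1

theorem tlu_of_CC {U : Filter ℕ} {f : ℕ → ℂ → ℂ} {F : ℂ → ℂ} {s : Set ℂ} (hs : IsOpen s)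
    (hF : ContinuousOn F s) (h : CC U f F s) : TendstoLocallyUniformlyOn f F U s := by
  rw [tendstoLocallyUniformlyOn_iff_forall_tendsto]
  intro w hw
  rw [hs.nhdsWithin_eq hw]
  have h2 : Tendsto (fun p : ℕ × ℂ => F p.2) (U ×ˢ 𝓝 w) (𝓝 (F w)) :=
    (hF.continuousAt (hs.mem_nhds hw)).tendsto.comp tendsto_snd
  exact (h2.prodMk_nhds (h w hw)).mono_right (nhds_le_uniformity _)

theorem CC.at {U : Filter ℕ} {f : ℕ → ℂ → ℂ} {F : ℂ → ℂ} {s : Set ℂ}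
    (h : CC U f F s) {w : ℂ} (hw : w ∈ s) : Tendsto (fun n => f n w) U (𝓝 (F w)) := by
  have h0 : Tendsto (fun n : ℕ => (n, w)) U (U ×ˢ 𝓝 w) :=
    tendsto_id.prodMk tendsto_const_nhds
  have := (h w hw).comp h0
  exact this

theorem deriv_bound {f : ℂ → ℂ} {z : ℂ} {r B : ℝ} (hr : 0 < r)
    (hf : DifferentiableOn ℂ f (ball z r)) (hB : ∀ w ∈ ball z r, ‖f w‖ ≤ B) :
    ‖deriv f z‖ ≤ 2 * B / r := by
  have h1 : closedBall z (r / 2) ⊆ ball z r := closedBall_subset_ball (by linarith)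
  have : ‖deriv f z‖ ≤ B / (r / 2) := by
    apply Complex.norm_deriv_le_of_forall_mem_sphere_norm_le (by positivity)
    · apply DifferentiableOn.diffContOnCl
      rw [closure_ball _ (by positivity)]
      exact hf.mono h1
    · intro w hw
      exact hB w (h1 (sphere_subset_closedBall hw))
  calc _ ≤ _ := this
    _ = _ := by field_simp

theorem lip_bound {f : ℂ → ℂ} {z : ℂ} {r B : ℝ} (hr : 0 < r)
    (hf : DifferentiableOn ℂ f (ball z r)) (hB : ∀ w ∈ ball z r, ‖f w‖ ≤ B) :
    ∀ w ∈ ball z (r / 2), ‖f w - f z‖ ≤ (4 * B / r) * ‖w - z‖ := by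
  intro w hw
  have hz : z ∈ ball z (r / 2) := mem_ball_self (by positivity)
  apply (convex_ball z (r / 2)).norm_image_sub_le_of_norm_deriv_le (𝕜 := ℂ) ?_ ?_ hz hw
  · intro x hx
    exact hf.differentiableAt (isOpen_ball.mem_nhds (ball_subset_ball (by linarith) hx))
  · intro x hx
    have hsub : ball x (r / 2) ⊆ ball z r := by
      apply ball_subset_ball'
      rw [mem_ball] at hx
      linarith
    have := deriv_bound (by positivity : 0 < r / 2) (hf.mono hsub) (fun w hw => hB w (hsub hw))
    calc _ ≤ _ := this
      _ = _ := by field_simp; ring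

theorem ultra_montel (U : Ultrafilter ℕ) (f : ℕ → ℂ → ℂ) (c B : ℝ)
    (hf : ∀ᶠ n in (U : Filter ℕ), DifferentiableOn ℂ (f n) (ball 0 c))
    (hB : ∀ᶠ n in (U : Filter ℕ), ∀ z ∈ ball (0 : ℂ) c, ‖f n z‖ ≤ B) :
    ∃ F : ℂ → ℂ, DifferentiableOn ℂ F (ball 0 c) ∧ CC U f F (ball 0 c) ∧
      CC U (fun n => deriv (f n)) (deriv F) (ball 0 c) ∧ ∀ w ∈ ball (0 : ℂ) c, ‖F w‖ ≤ B := by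
  have hlim : ∀ w ∈ ball (0 : ℂ) c, ∃ y, Tendsto (fun n => f n w) U (𝓝 y) := by
    intro w hw
    have hc := isCompact_closedBall (0 : ℂ) B
    have : closedBall (0 : ℂ) B ∈ U.map (fun n => f n w) := by
      rw [Ultrafilter.mem_map]
      filter_upwards [hB] with n hn
      simpa using hn w hw
    obtain ⟨y, _, hy⟩ := hc.ultrafilter_le_nhds (U.map (fun n => f n w))
      (by rw [le_principal_iff]; exact this)
    exact ⟨y, hy⟩
  choose! F hF using hlim
  have hFB : ∀ w ∈ ball (0 : ℂ) c, ‖F w‖ ≤ B := by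
    intro w hw
    apply le_of_tendsto (hF w hw).norm
    filter_upwards [hB] with n hn using hn w hw
  have hCC : CC U f F (ball 0 c) := by
    intro w hw
    obtain ⟨r, hr, hrs⟩ := Metric.isOpen_iff.1 (isOpen_ball : IsOpen (ball (0:ℂ) c)) w hw
    have h1 : Tendsto (fun p : ℕ × ℂ => f p.1 w) (U ×ˢ 𝓝 w) (𝓝 (F w)) :=
      (hF w hw).comp tendsto_fst
    have h2 : Tendsto (fun p : ℕ × ℂ => f p.1 p.2 - f p.1 w) (U ×ˢ 𝓝 w) (𝓝 0) := by
      apply squeeze_zero_norm' (a := fun p : ℕ × ℂ => (4 * B / r) * ‖p.2 - w‖)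
      · have := (hf.and hB).prod_mk (ball_mem_nhds w (by positivity : 0 < r / 2))
        filter_upwards [this] with p hp
        exact lip_bound hr (hp.1.1.mono hrs) (fun x hx => hp.1.2 x (hrs hx)) p.2 hp.2
      · have : Tendsto (fun z : ℂ => (4 * B / r) * ‖z - w‖) (𝓝 w) (𝓝 0) := by
          have : ContinuousAt (fun z : ℂ => (4 * B / r) * ‖z - w‖) w := by fun_prop
          simpa [ContinuousAt] using this
        exact this.comp tendsto_snd
    simpa using h2.add h1
  have hFc : ContinuousOn F (ball 0 c) := by
    intro w hw
    apply ContinuousAt.continuousWithinAt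
    obtain ⟨r, hr, hrs⟩ := Metric.isOpen_iff.1 (isOpen_ball : IsOpen (ball (0:ℂ) c)) w hw
    have : ∀ z ∈ ball w (r / 2), ‖F z - F w‖ ≤ (4 * B / r) * ‖z - w‖ := by
      intro z hz
      have hz' : z ∈ ball (0:ℂ) c := hrs (ball_subset_ball (by linarith) hz)
      apply le_of_tendsto ((hF z hz').sub (hF w hw)).norm
      filter_upwards [hf, hB] with n h1 h2
      exact lip_bound hr (h1.mono hrs) (fun x hx => h2 x (hrs hx)) z hz
    rw [ContinuousAt, tendsto_iff_norm_sub_tendsto_zero]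
    apply squeeze_zero' (g := fun z => (4 * B / r) * ‖z - w‖) (Eventually.of_forall fun _ => norm_nonneg _)
    · filter_upwards [ball_mem_nhds w (by positivity : 0 < r / 2)] with z hz using this z hz
    · have : ContinuousAt (fun z : ℂ => (4 * B / r) * ‖z - w‖) w := by fun_prop
      simpa [ContinuousAt] using this
  have htlu := tlu_of_CC isOpen_ball hFc hCC
  have hFd : DifferentiableOn ℂ F (ball 0 c) := htlu.differentiableOn hf isOpen_ball
  refine ⟨F, hFd, hCC, ?_, hFB⟩
  apply CC_of_tlu isOpen_ball (hFd.deriv isOpen_ball).continuousOn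
  exact htlu.deriv hf isOpen_ball

end Isl


namespace Isl
open Set Metric Filter Topology

theorem ana_of_diff {f : ℂ → ℂ} {c : ℂ} {r : ℝ} (hf : DifferentiableOn ℂ f (ball c r)) :
    AnalyticOnNhd ℂ f (ball c r) := hf.analyticOnNhd isOpen_ball

/-- Zeros of a nonzero analytic function on a ball are isolated. -/
theorem ev_ne {g : ℂ → ℂ} {c : ℂ} {r : ℝ} (hg : DifferentiableOn ℂ g (ball c r))
    (hne : ∃ w ∈ ball c r, g w ≠ 0) {w : ℂ} (hw : w ∈ ball c r) :
    ∀ᶠ z in 𝓝[≠] w, g z ≠ 0 := by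
  rcases ((ana_of_diff hg) w hw).eventually_eq_zero_or_eventually_ne_zero with h | h
  · obtain ⟨w0, hw0, hne⟩ := hne
    exact absurd ((ana_of_diff hg).eqOn_zero_of_preconnected_of_eventuallyEq_zero
      (convex_ball c r).isPreconnected hw h hw0) hne
  · exact h

theorem quot {f g : ℂ → ℂ} {c : ℂ} {r : ℝ} (hf : DifferentiableOn ℂ f (ball c r))
    (hg : DifferentiableOn ℂ g (ball c r)) (hne : ∃ w ∈ ball c r, g w ≠ 0)
    (hloc : ∀ w ∈ ball c r, ∃ C : ℝ, ∀ᶠ z in 𝓝 w, ‖f z‖ ≤ C * ‖g z‖) :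
    ∃ Q : ℂ → ℂ, DifferentiableOn ℂ Q (ball c r) ∧ (∀ w ∈ ball c r, f w = Q w * g w) ∧
      ∀ w ∈ ball c r, Tendsto (fun z => f z / g z) (𝓝[≠] w) (𝓝 (Q w)) := by
  set q : ℂ → ℂ := fun z => f z / g z with hq
  set Q : ℂ → ℂ := fun w => limUnder (𝓝[≠] w) q with hQ
  have hcont : ∀ z ∈ ball c r, g z ≠ 0 → Q z = q z := by
    intro z hz hgz
    have h1 : ContinuousAt q z :=
      (hf.continuousOn.continuousAt (isOpen_ball.mem_nhds hz)).div
        (hg.continuousOn.continuousAt (isOpen_ball.mem_nhds hz)) hgz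
    exact (h1.tendsto.mono_left nhdsWithin_le_nhds).limUnder_eq
  have key : ∀ w ∈ ball c r, DifferentiableAt ℂ Q w ∧ Tendsto q (𝓝[≠] w) (𝓝 (Q w)) := by
    intro w hw
    obtain ⟨C, hC⟩ := hloc w hw
    have h1 := ev_ne hg hne hw
    rw [eventually_nhdsWithin_iff] at h1
    obtain ⟨s, hs, hsb⟩ := Metric.eventually_nhds_iff_ball.1
      ((h1.and hC).and (isOpen_ball.mem_nhds hw))
    have hsn : ball w s ∈ 𝓝 w := ball_mem_nhds w hs
    have hd : DifferentiableOn ℂ q (ball w s \ {w}) := by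
      intro z hz
      have hz' := hsb z hz.1
      apply DifferentiableAt.differentiableWithinAt
      exact (hf.differentiableAt (isOpen_ball.mem_nhds hz'.2)).div
        (hg.differentiableAt (isOpen_ball.mem_nhds hz'.2)) (hz'.1.1 hz.2)
    have hbd : ∀ z ∈ ball w s \ {w}, ‖q z‖ ≤ C := by
      intro z hz
      have hz' := hsb z hz.1
      have hg0 : 0 < ‖g z‖ := norm_pos_iff.2 (hz'.1.1 hz.2)
      simp only [hq, norm_div]
      rw [div_le_iff₀ hg0]
      exact hz'.1.2
    have hb : BddAbove (norm ∘ q '' (ball w s \ {w})) := by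
      refine ⟨C, ?_⟩
      rintro _ ⟨z, hz, rfl⟩
      exact hbd z hz
    have hlim := Complex.tendsto_limUnder_of_differentiable_on_punctured_nhds_of_bounded_under
      (f := q) (c := w) (by
        rw [eventually_nhdsWithin_iff]
        filter_upwards [hsn] with z hz hzw
        have hz' := hsb z hz
        exact (hf.differentiableAt (isOpen_ball.mem_nhds hz'.2)).div
          (hg.differentiableAt (isOpen_ball.mem_nhds hz'.2)) (hz'.1.1 hzw))
      (by
        refine ⟨C + ‖q w‖, ?_⟩
        rw [eventually_map, eventually_nhdsWithin_iff]
        filter_upwards [hsn] with z hz hzw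
        have h2 : ‖q z‖ ≤ C := hbd z ⟨hz, hzw⟩
        calc ‖q z - q w‖ ≤ ‖q z‖ + ‖q w‖ := norm_sub_le _ _
          _ ≤ _ := by linarith)
    have hu := Complex.differentiableOn_update_limUnder_of_bddAbove hsn hd hb
    refine ⟨?_, hlim⟩
    have h2 : DifferentiableAt ℂ (Function.update q w (limUnder (𝓝[≠] w) q)) w :=
      hu.differentiableAt hsn
    apply h2.congr_of_eventuallyEq
    filter_upwards [hsn] with z hz
    by_cases hzw : z = w
    · subst hzw; simp [hQ]
    · rw [Function.update_of_ne hzw]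
      exact hcont z (hsb z hz).2 ((hsb z hz).1.1 hzw)
  refine ⟨Q, fun w hw => (key w hw).1.differentiableWithinAt, ?_, fun w hw => (key w hw).2⟩
  intro w hw
  by_cases hgw : g w = 0
  · obtain ⟨C, hC⟩ := hloc w hw
    have := hC.self_of_nhds
    rw [hgw] at this ⊢
    simpa using this
  · rw [hcont w hw hgw, hq]
    field_simp

end Isl


namespace Isl
open Set Metric Filter Topology

theorem loc_bd {u : ℂ → ℂ} {w : ℂ} (hu : AnalyticAt ℂ u w) (hc : u w = 0 → deriv u w = 0) :
    ∃ C : ℝ, 0 ≤ C ∧ ∀ᶠ z in 𝓝 w, ‖deriv u z‖ ^ 2 ≤ C * ‖u z‖ := by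
  by_cases h0 : ∀ᶠ z in 𝓝 w, u z = 0
  · refine ⟨0, le_rfl, ?_⟩
    filter_upwards [h0.eventually_nhds] with z hz
    have : u =ᶠ[𝓝 z] fun _ => 0 := hz
    rw [this.deriv_eq]; simp
  obtain ⟨n, v, hv, hv0, hev⟩ := hu.exists_eventuallyEq_pow_smul_nonzero_iff.2 h0
  have hvc : ∀ᶠ z in 𝓝 w, v z ≠ 0 := hv.continuousAt.eventually_ne hv0
  have hvd : ∀ᶠ z in 𝓝 w, AnalyticAt ℂ v z := hv.eventually_analyticAt
  have hd : ∀ᶠ z in 𝓝 w, deriv u z = n * (z - w) ^ (n - 1) * v z + (z - w) ^ n * deriv v z := by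
    filter_upwards [hev.eventually_nhds, hvd] with z hz hvz
    have h1 : u =ᶠ[𝓝 z] fun z => (z - w) ^ n * v z := by
      filter_upwards [hz] with y hy; simpa using hy
    rw [h1.deriv_eq]
    have h2 : HasDerivAt (fun z => (z - w) ^ n * v z)
        ((n * (z - w) ^ (n - 1) * 1) * v z + (z - w) ^ n * deriv v z) z :=
      (((hasDerivAt_id z).sub_const w).pow n).mul hvz.differentiableAt.hasDerivAt
    rw [h2.deriv]; ring
  match n, hev, hd with
  | 0, hev, hd =>
    have hk : ContinuousAt (fun z => ‖deriv u z‖ ^ 2 / ‖u z‖) w := by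
      have : u w ≠ 0 := by have := hev.self_of_nhds; simp at this; rw [this]; exact hv0
      exact (hu.deriv.continuousAt.norm.pow 2).div hu.continuousAt.norm (norm_ne_zero_iff.2 this)
    refine ⟨‖deriv u w‖ ^ 2 / ‖u w‖ + 1, by positivity, ?_⟩
    filter_upwards [hk.eventually (gt_mem_nhds (lt_add_one _)), hev, hvc] with z hz h1 h2
    have : u z ≠ 0 := by simp at h1; rwa [h1]
    rw [div_lt_iff₀ (norm_pos_iff.2 this)] at hz
    exact hz.le
  | 1, hev, hd =>
    exfalso
    have h1 := hev.self_of_nhds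
    have h2 := hd.self_of_nhds
    simp at h1 h2
    exact hv0 (h2.symm.trans (hc h1))
  | (m + 2), hev, hd =>
    have hk : ContinuousAt (fun z => ‖z - w‖ ^ m * ‖((m:ℂ) + 2) * v z + (z - w) * deriv v z‖ ^ 2 / ‖v z‖) w := by
      have a1 := hv.continuousAt
      have a2 := hv.deriv.continuousAt
      apply ContinuousAt.div _ a1.norm (norm_ne_zero_iff.2 hv0)
      fun_prop
    refine ⟨|‖w - w‖ ^ m * ‖((m:ℂ) + 2) * v w + (w - w) * deriv v w‖ ^ 2 / ‖v w‖| + 1, by positivity, ?_⟩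
    filter_upwards [hk.eventually (gt_mem_nhds (lt_of_le_of_lt (le_abs_self _) (lt_add_one _))), hev, hvc, hd]
      with z hz h1 h2 h3
    have hvp : 0 < ‖v z‖ := norm_pos_iff.2 h2
    rw [div_lt_iff₀ hvp] at hz
    rw [h1, h3]
    have e1 : ((m + 2 : ℕ) : ℂ) * (z - w) ^ (m + 2 - 1) * v z + (z - w) ^ (m + 2) * deriv v z
        = (z - w) ^ (m + 1) * (((m:ℂ) + 2) * v z + (z - w) * deriv v z) := by
      push_cast
      ring
    rw [e1, norm_mul, norm_pow, smul_eq_mul, norm_mul, norm_pow]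
    have e2 := mul_le_mul_of_nonneg_left hz.le (by positivity : 0 ≤ ‖z - w‖ ^ (m + 2))
    calc _ = ‖z - w‖ ^ (m + 2) * (‖z - w‖ ^ m * ‖((m:ℂ) + 2) * v z + (z - w) * deriv v z‖ ^ 2) := by ring
      _ ≤ _ := e2
      _ = _ := by ring

/-- Landau type inequality for holomorphic functions with only multiple zeros. -/
theorem landau {u : ℂ → ℂ} {r B : ℝ} (hr : 0 < r) (hu : DifferentiableOn ℂ u (ball 0 r))
    (hB : ∀ w ∈ ball (0:ℂ) r, ‖u w‖ ≤ B) (hc : ∀ w ∈ ball (0:ℂ) r, u w = 0 → deriv u w = 0) :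
    ‖deriv u 0‖ ^ 2 ≤ 768 * B / r ^ 2 * ‖u 0‖ := by
  have h00 : (0:ℂ) ∈ ball (0:ℂ) r := mem_ball_self hr
  have hB0 : 0 ≤ B := (norm_nonneg _).trans (hB 0 h00)
  by_cases hne : ∃ w ∈ ball (0:ℂ) r, u w ≠ 0
  swap
  · push Not at hne
    rw [hc 0 h00 (hne 0 h00)]
    rw [norm_zero]
    have : 0 ≤ 768 * B / r ^ 2 * ‖u 0‖ := by positivity
    simpa using this
  have hu' : DifferentiableOn ℂ (deriv u) (ball 0 r) := hu.deriv isOpen_ball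
  obtain ⟨p, hp, hpe, -⟩ := quot (f := fun z => deriv u z ^ 2) (g := u) (hu'.pow 2) hu hne (by
    intro w hw
    obtain ⟨C, -, hC⟩ := loc_bd (ana_of_diff hu w hw) (hc w hw)
    refine ⟨C, ?_⟩
    filter_upwards [hC] with z hz
    rwa [norm_pow])
  -- key identity
  have hid : ∀ z ∈ ball (0:ℂ) r, 2 * deriv (deriv u) z * p z = deriv p z * deriv u z + p z ^ 2 := by
    have hmul : ∀ z ∈ ball (0:ℂ) r,
        (2 * deriv (deriv u) z * p z - (deriv p z * deriv u z + p z ^ 2)) * u z = 0 := by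
      intro z hz
      have hn := isOpen_ball.mem_nhds hz
      have d1 : HasDerivAt (fun z => deriv u z ^ 2) (2 * deriv u z * deriv (deriv u) z) z := by
        have := ((hu'.differentiableAt hn).hasDerivAt).pow 2
        have e : (deriv u ^ 2) = fun z => deriv u z ^ 2 := rfl
        rw [e] at this
        have e2 : (2 * deriv u z * deriv (deriv u) z) = ((2:ℕ):ℂ) * deriv u z ^ (2 - 1) * deriv (deriv u) z := by
          norm_num
        rw [e2]
        exact this
      have d2 : HasDerivAt (fun z => p z * u z) (deriv p z * u z + p z * deriv u z) z :=
        ((hp.differentiableAt hn).hasDerivAt).mul ((hu.differentiableAt hn).hasDerivAt)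
      have d3 : HasDerivAt (fun z => deriv u z ^ 2) (deriv p z * u z + p z * deriv u z) z := by
        apply d2.congr_of_eventuallyEq
        filter_upwards [hn] with y hy using hpe y hy
      have e := d1.unique d3
      have e2 := hpe z hz
      have h3 : 2 * deriv u z ^ 2 * deriv (deriv u) z
          = deriv p z * deriv u z * u z + p z * deriv u z ^ 2 := by
        linear_combination (deriv u z) * e
      rw [e2] at h3
      linear_combination h3
    have hX : DifferentiableOn ℂ
        (fun z => 2 * deriv (deriv u) z * p z - (deriv p z * deriv u z + p z ^ 2)) (ball 0 r) := by
      have := hu'.deriv isOpen_ball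
      have := hp.deriv isOpen_ball
      fun_prop
    intro z hz
    by_contra hcon
    have hX0 := ev_ne hX ⟨z, hz, sub_ne_zero.2 hcon⟩ hz
    have hu0 := ev_ne hu hne hz
    have hb : ∀ᶠ y in 𝓝[≠] z, y ∈ ball (0:ℂ) r := nhdsWithin_le_nhds (isOpen_ball.mem_nhds hz)
    obtain ⟨y, ⟨hy1, hy2⟩, hy3⟩ := ((hX0.and hu0).and hb).exists
    exact (mul_ne_zero hy1 hy2) (hmul y hy3)
  set r1 := r / 2 with hr1
  have hsub : closedBall (0:ℂ) r1 ⊆ ball 0 r := closedBall_subset_ball (by rw [hr1]; linarith)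
  have hcts : ContinuousOn (fun z : ℂ => ‖p z‖ * (r1 - ‖z‖) ^ 2) (closedBall 0 r1) := by
    have := hp.continuousOn.mono hsub
    fun_prop
  obtain ⟨z0, hz0, hmax⟩ := (isCompact_closedBall (0:ℂ) r1).exists_isMaxOn
    ⟨0, mem_closedBall_self (by positivity)⟩ hcts
  have hz0r := hsub hz0
  have hm0 := hmax (mem_closedBall_self (by positivity : 0 ≤ r1))
  simp only [mem_ofPred_eq, norm_zero, sub_zero] at hm0
  have goal1 : ‖p 0‖ ≤ 768 * B / r ^ 2 → ‖deriv u 0‖ ^ 2 ≤ 768 * B / r ^ 2 * ‖u 0‖ := by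
    intro h
    have := hpe 0 h00
    rw [← norm_pow, this, norm_mul]
    gcongr
  apply goal1
  set l := ‖p z0‖ with hl
  set s := (r1 - ‖z0‖) / 2 with hs
  have hz0' : ‖z0‖ ≤ r1 := by simpa using hz0
  have hs0 : 0 ≤ s := by rw [hs]; linarith
  have hr1p : 0 < r1 := by positivity
  rcases hs0.eq_or_lt with hs0 | hs0
  · have : r1 - ‖z0‖ = 0 := by linarith
    rw [this] at hm0
    have : ‖p 0‖ * r1 ^ 2 ≤ 0 := by simpa using hm0
    have h2 : ‖p 0‖ ≤ 0 := by
      by_contra h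
      push Not at h
      have : 0 < ‖p 0‖ * r1 ^ 2 := by positivity
      linarith
    exact h2.trans (by positivity)
  have hbs : ball z0 s ⊆ ball (0:ℂ) r := by
    apply ball_subset_ball'
    rw [dist_zero_right]; linarith
  have hp4 : ∀ z ∈ ball z0 s, ‖p z‖ ≤ 4 * l := by
    intro z hz
    have hzn : ‖z‖ ≤ ‖z0‖ + s := by
      have : ‖z - z0‖ < s := by simpa [dist_eq_norm] using hz
      have h2 := norm_add_le z0 (z - z0)
      simp at h2; linarith
    have hzc : z ∈ closedBall (0:ℂ) r1 := by simp; linarith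
    have h1 := hmax hzc
    simp only [mem_ofPred_eq] at h1
    have h2 : s ≤ r1 - ‖z‖ := by linarith
    have h3 : ‖p z‖ * s ^ 2 ≤ ‖p z‖ * (r1 - ‖z‖) ^ 2 := by gcongr
    have h4 : ‖p z0‖ * (r1 - ‖z0‖) ^ 2 = 4 * l * s ^ 2 := by rw [hs]; ring
    have h5 : ‖p z‖ * s ^ 2 ≤ 4 * l * s ^ 2 := by linarith
    exact le_of_mul_le_mul_right h5 (by positivity)
  have hu1 : ‖deriv u z0‖ ≤ 2 * B / s :=
    deriv_bound hs0 (hu.mono hbs) (fun w hw => hB w (hbs hw))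
  have hu2 : ‖deriv (deriv u) z0‖ ≤ 16 * B / s ^ 2 := by
    have : ‖deriv (deriv u) z0‖ ≤ 2 * (4 * B / s) / (s / 2) := by
      apply deriv_bound (by positivity)
        (hu'.mono ((ball_subset_ball (by linarith)).trans hbs))
      intro w hw
      have hw2 : ball w (s / 2) ⊆ ball z0 s := by
        apply ball_subset_ball'
        rw [mem_ball] at hw; linarith
      have := deriv_bound (by positivity : 0 < s / 2) (hu.mono (hw2.trans hbs))
        (fun y hy => hB y (hbs (hw2 hy)))
      calc _ ≤ _ := this
        _ = _ := by field_simp; ring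
    calc _ ≤ _ := this
      _ = _ := by field_simp; ring
  have hp1 : ‖deriv p z0‖ ≤ 2 * (4 * l) / s := deriv_bound hs0 (hp.mono hbs) hp4
  have hlB : l ≤ 48 * B / s ^ 2 := by
    by_contra hcon
    push Not at hcon
    have hl0 : 0 < l := lt_of_le_of_lt (by positivity) hcon
    have e := hid z0 hz0r
    have e1 : p z0 ^ 2 = 2 * deriv (deriv u) z0 * p z0 - deriv p z0 * deriv u z0 := by
      linear_combination -e
    have e2 : l ^ 2 ≤ 2 * (16 * B / s ^ 2) * l + (2 * (4 * l) / s) * (2 * B / s) := by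
      calc l ^ 2 = ‖p z0 ^ 2‖ := by rw [norm_pow]
        _ ≤ ‖2 * deriv (deriv u) z0 * p z0‖ + ‖deriv p z0 * deriv u z0‖ := by
            rw [e1]; exact norm_sub_le _ _
        _ ≤ _ := by
            rw [norm_mul, norm_mul, norm_mul]
            simp only [Complex.norm_ofNat]
            gcongr
    have e3 : l ^ 2 ≤ 48 * B / s ^ 2 * l := by
      calc _ ≤ _ := e2
        _ = _ := by field_simp; ring
    have e4 : l ≤ 48 * B / s ^ 2 := by
      apply le_of_mul_le_mul_right _ hl0
      linarith [sq l]
    linarith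
  have h5 : ‖p 0‖ * r1 ^ 2 ≤ 192 * B := by
    calc _ ≤ _ := hm0
      _ = 4 * s ^ 2 * l := by rw [hs]; ring
      _ ≤ 4 * s ^ 2 * (48 * B / s ^ 2) := by gcongr
      _ = _ := by field_simp; ring
  rw [le_div_iff₀ (by positivity)]
  have : r ^ 2 = 4 * r1 ^ 2 := by rw [hr1]; ring
  rw [this]; linarith

end Isl


namespace Isl
open Set Metric Filter Topology

/-- The linear form `G - α H` in the normalised frame. -/
noncomputable def lin (α a b x : ℂ) : ℂ :=
  (b - α * a) + ((starRingEnd ℂ) a + α * (starRingEnd ℂ) b) * x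

/-- The comparison function. -/
noncomputable def NN (α : Fin 7 → ℂ) (a b x d : ℂ) : ℝ :=
  ‖d‖ ^ 2 * Real.sqrt (1 + ‖x‖ ^ 2) / ∏ j, ‖lin (α j) a b x‖

/-- Normalised charts all of whose `α j`-points are multiple. -/
structure Trip (α : Fin 7 → ℂ) (a b : ℂ) (ρ : ℂ → ℂ) : Prop where
  unit : ‖a‖ ^ 2 + ‖b‖ ^ 2 = 1
  diff : DifferentiableOn ℂ ρ (ball 0 (1 / 8))
  bd : ∀ w ∈ ball (0:ℂ) (1 / 8), ‖ρ w‖ ≤ 1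
  zero : ρ 0 = 0
  mult : ∀ j, ∀ w ∈ ball (0:ℂ) (1 / 8), lin (α j) a b (ρ w) = 0 → deriv ρ w = 0

theorem NN_nonneg (α : Fin 7 → ℂ) (a b x d : ℂ) : 0 ≤ NN α a b x d := by
  unfold NN; positivity

theorem frame_norm (a b x : ℂ) (h : ‖a‖ ^ 2 + ‖b‖ ^ 2 = 1) :
    ‖a - (starRingEnd ℂ) b * x‖ ^ 2 + ‖b + (starRingEnd ℂ) a * x‖ ^ 2 = 1 + ‖x‖ ^ 2 := by
  rw [← Complex.normSq_eq_norm_sq, ← Complex.normSq_eq_norm_sq] at h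
  simp only [← Complex.normSq_eq_norm_sq]
  simp only [Complex.normSq_apply, Complex.add_re, Complex.add_im, Complex.sub_re, Complex.sub_im,
    Complex.mul_re, Complex.mul_im, Complex.conj_re, Complex.conj_im] at *
  linear_combination (1 + x.re * x.re + x.im * x.im) * h

theorem lin_eq (α a b x : ℂ) :
    lin α a b x = (b + (starRingEnd ℂ) a * x) - α * (a - (starRingEnd ℂ) b * x) := by
  unfold lin; ring

theorem AB_norm (α a b : ℂ) (h : ‖a‖ ^ 2 + ‖b‖ ^ 2 = 1) :
    ‖(starRingEnd ℂ) a + α * (starRingEnd ℂ) b‖ ^ 2 + ‖b - α * a‖ ^ 2 = 1 + ‖α‖ ^ 2 := by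
  rw [← Complex.normSq_eq_norm_sq, ← Complex.normSq_eq_norm_sq] at h
  simp only [← Complex.normSq_eq_norm_sq]
  simp only [Complex.normSq_apply, Complex.add_re, Complex.add_im, Complex.sub_re, Complex.sub_im,
    Complex.mul_re, Complex.mul_im, Complex.conj_re, Complex.conj_im] at *
  linear_combination (1 + α.re * α.re + α.im * α.im) * h

theorem unit_le (a b : ℂ) (h : ‖a‖ ^ 2 + ‖b‖ ^ 2 = 1) : ‖a‖ ≤ 1 ∧ ‖b‖ ≤ 1 ∧ 1 ≤ ‖a‖ + ‖b‖ := by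
  have h1 := norm_nonneg a
  have h2 := norm_nonneg b
  refine ⟨?_, ?_, ?_⟩ <;> nlinarith

theorem sep (α : Fin 7 → ℂ) (hα : Function.Injective α) :
    ∃ δ : ℝ, 0 < δ ∧ δ ≤ 1 / 2 ∧ ∀ a b : ℂ, ‖a‖ ^ 2 + ‖b‖ ^ 2 = 1 → ∀ i j, i ≠ j →
      ‖b - α i * a‖ < δ → δ ≤ ‖b - α j * a‖ := by
  let f : {p : Fin 7 × Fin 7 // p.1 ≠ p.2} → ℝ := fun p =>
    ‖α p.1.1 - α p.1.2‖ / (3 + ‖α p.1.1‖ + ‖α p.1.2‖)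
  have : Nonempty {p : Fin 7 × Fin 7 // p.1 ≠ p.2} := ⟨⟨(0, 1), by decide⟩⟩
  obtain ⟨p0, hp0⟩ := Finite.exists_min f
  have hfp : 0 < f p0 := by
    have : α p0.1.1 - α p0.1.2 ≠ 0 := sub_ne_zero.2 (fun h => p0.2 (hα h))
    have := norm_pos_iff.2 this
    simp only [f]; positivity
  refine ⟨min (f p0) (1 / 2), by positivity, min_le_right _ _, ?_⟩
  intro a b hab i j hij hi
  by_contra hj
  push Not at hj
  have hle := hp0 ⟨(i, j), hij⟩
  have hi' := hi.trans_le ((min_le_left _ _).trans hle)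
  have hj' := hj.trans_le ((min_le_left _ _).trans hle)
  simp only [f] at hi' hj'
  set D := ‖α i - α j‖ with hD
  set E := 3 + ‖α i‖ + ‖α j‖ with hE
  have hEp : 0 < E := by positivity
  have hDp : 0 < D := norm_pos_iff.2 (sub_ne_zero.2 (fun h => hij (hα h)))
  have e1 : (α i - α j) * a = (b - α j * a) - (b - α i * a) := by ring
  have e2 : (α i - α j) * b = α i * (b - α j * a) - α j * (b - α i * a) := by ring
  have n1 : D * ‖a‖ ≤ ‖b - α j * a‖ + ‖b - α i * a‖ := by
    rw [hD, ← norm_mul, e1]; exact norm_sub_le _ _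
  have n2 : D * ‖b‖ ≤ ‖α i‖ * ‖b - α j * a‖ + ‖α j‖ * ‖b - α i * a‖ := by
    rw [hD, ← norm_mul, e2, ← norm_mul, ← norm_mul]; exact norm_sub_le _ _
  have n3 := (unit_le a b hab).2.2
  have n4 : D ≤ D * ‖a‖ + D * ‖b‖ := by nlinarith
  have n5 : ‖α i‖ * ‖b - α j * a‖ ≤ ‖α i‖ * (D / E) := by gcongr
  have n6 : ‖α j‖ * ‖b - α i * a‖ ≤ ‖α j‖ * (D / E) := by gcongr
  have n7 : D < (3 + ‖α i‖ + ‖α j‖) * (D / E) := by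
    have : 0 < D / E := by positivity
    nlinarith
  rw [← hE] at n7
  have : E * (D / E) = D := by field_simp
  linarith

theorem lemX (α : Fin 7 → ℂ) (hα : Function.Injective α) :
    ∃ C : ℝ, 0 ≤ C ∧ ∀ a b ρ, Trip α a b ρ → ∀ s : ℝ, s ≤ 1 →
      (∀ w ∈ ball (0:ℂ) (1 / 16), ‖ρ w‖ ≤ s) → NN α a b 0 (deriv ρ 0) ≤ C * s := by
  obtain ⟨δ, hδ, hδ2, hsep⟩ := sep α hα
  obtain ⟨j0, hj0⟩ := Finite.exists_max (fun j => ‖α j‖)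
  set K := 1 + ‖α j0‖ with hK
  set C1 : ℝ := 4 / 3 * 768 * 256 * (1 + K) with hC1
  have hK1 : 1 ≤ K := by rw [hK]; linarith [norm_nonneg (α j0)]
  refine ⟨C1 / δ ^ 7, by positivity, ?_⟩
  intro a b ρ T s hs1 hs
  have hs0 : 0 ≤ s := (norm_nonneg _).trans (hs 0 (mem_ball_self (by norm_num)))
  have hsub : ball (0:ℂ) (1 / 16) ⊆ ball 0 (1 / 8) := ball_subset_ball (by norm_num)
  have hd : ‖deriv ρ 0‖ ≤ 32 * s := by
    have := deriv_bound (by norm_num : (0:ℝ) < 1 / 16) (T.diff.mono hsub) hs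
    linarith
  have hd2 : ‖deriv ρ 0‖ ^ 2 ≤ 1024 * s ^ 2 := by
    calc _ ≤ (32 * s) ^ 2 := by gcongr
      _ = _ := by ring
  have hlin0 : ∀ j, lin (α j) a b 0 = b - α j * a := by intro j; simp [lin]
  have hA : ∀ j, ‖(starRingEnd ℂ) a + α j * (starRingEnd ℂ) b‖ ≤ K := by
    intro j
    have h1 := unit_le a b T.unit
    calc _ ≤ ‖(starRingEnd ℂ) a‖ + ‖α j * (starRingEnd ℂ) b‖ := norm_add_le _ _
      _ ≤ 1 + ‖α j0‖ * 1 := by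
        rw [norm_mul, RCLike.norm_conj, RCLike.norm_conj]
        gcongr
        · exact h1.1
        · exact hj0 j
        · exact h1.2.1
      _ = K := by rw [hK]; ring
  unfold NN
  simp only [hlin0, norm_zero]
  have hsq : Real.sqrt (1 + 0 ^ 2) = 1 := by norm_num
  rw [hsq, mul_one]
  by_cases hall : ∀ j, δ ≤ ‖b - α j * a‖
  · have hprod : δ ^ 7 ≤ ∏ j, ‖b - α j * a‖ := by
      calc δ ^ 7 = ∏ j : Fin 7, δ := by simp
        _ ≤ _ := Finset.prod_le_prod (fun _ _ => hδ.le) (fun j _ => hall j)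
    rw [div_mul_eq_mul_div]
    gcongr
    calc _ ≤ _ := hd2
      _ ≤ 1024 * s := by nlinarith
      _ ≤ _ := by
        gcongr
        rw [hC1]; nlinarith
  · push Not at hall
    obtain ⟨i, hi⟩ := hall
    set β := b - α i * a with hβ
    have key : ‖deriv ρ 0‖ ^ 2 ≤ C1 * s * ‖β‖ := by
      rcases le_total s ‖β‖ with h | h
      · calc _ ≤ _ := hd2
          _ = 1024 * s * s := by ring
          _ ≤ 1024 * s * ‖β‖ := by gcongr
          _ ≤ _ := by gcongr; rw [hC1]; nlinarith
      · set A := (starRingEnd ℂ) a + α i * (starRingEnd ℂ) b with hAd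
        have hA2 : 3 / 4 ≤ ‖A‖ ^ 2 := by
          have h1 := AB_norm (α i) a b T.unit
          have h2 : ‖β‖ ^ 2 ≤ (1 / 2) ^ 2 := by gcongr; linarith
          rw [← hβ, ← hAd] at h1
          nlinarith [sq_nonneg ‖α i‖]
        have hder : ∀ w ∈ ball (0:ℂ) (1 / 16), HasDerivAt (fun w => β + A * ρ w) (A * deriv ρ w) w := by
          intro w hw
          exact ((T.diff.differentiableAt (isOpen_ball.mem_nhds (hsub hw))).hasDerivAt.const_mul A).const_add β
        have := landau (u := fun w => β + A * ρ w) (r := 1 / 16) (B := (1 + K) * s) (by norm_num)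
          (fun w hw => (hder w hw).differentiableAt.differentiableWithinAt)
          (by
            intro w hw
            calc _ ≤ ‖β‖ + ‖A * ρ w‖ := norm_add_le _ _
              _ ≤ s + K * s := by
                rw [norm_mul]
                gcongr
                · exact hA i
                · exact hs w hw
              _ = _ := by ring)
          (by
            intro w hw h0
            rw [(hder w hw).deriv, T.mult i w (hsub hw) h0, mul_zero])
        rw [(hder 0 (mem_ball_self (by norm_num))).deriv, T.zero, norm_mul, mul_pow] at this
        simp only [mul_zero, add_zero] at this
        have h3 : 3 / 4 * ‖deriv ρ 0‖ ^ 2 ≤ 768 * ((1 + K) * s) / (1 / 16) ^ 2 * ‖β‖ :=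
          (by gcongr : 3 / 4 * ‖deriv ρ 0‖ ^ 2 ≤ ‖A‖ ^ 2 * ‖deriv ρ 0‖ ^ 2).trans this
        have h4 : 768 * ((1 + K) * s) / (1 / 16) ^ 2 * ‖β‖ = 3 / 4 * (C1 * s * ‖β‖) := by
          rw [hC1]; ring
        linarith
    rcases eq_or_ne β 0 with h0 | h0
    · have : ∏ j, ‖b - α j * a‖ = 0 :=
        Finset.prod_eq_zero (Finset.mem_univ i) (by rw [← hβ, h0, norm_zero])
      rw [this, div_zero]; positivity
    · have hβp := norm_pos_iff.2 h0
      have hprod : ‖β‖ * δ ^ 6 ≤ ∏ j, ‖b - α j * a‖ := by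
        rw [← Finset.mul_prod_erase _ _ (Finset.mem_univ i)]
        gcongr
        calc δ ^ 6 = ∏ j ∈ Finset.univ.erase i, δ := by simp
          _ ≤ _ := Finset.prod_le_prod (fun _ _ => hδ.le) (fun j hj =>
            hsep a b T.unit i j (Finset.ne_of_mem_erase hj).symm hi)
      calc _ ≤ C1 * s * ‖β‖ / (‖β‖ * δ ^ 6) := by gcongr
        _ = C1 * s / δ ^ 6 := by field_simp
        _ ≤ C1 * s / δ ^ 7 := by
          apply div_le_div_of_nonneg_left (by positivity) (by positivity)
          calc δ ^ 7 = δ ^ 6 * δ := by ring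
            _ ≤ δ ^ 6 * 1 := by gcongr; linarith
            _ = δ ^ 6 := by ring
        _ = _ := by ring

end Isl


namespace Isl
open Set Metric Filter Topology

theorem lin_cont {α a b : ℂ} {ρ : ℂ → ℂ} {s : Set ℂ} (h : DifferentiableOn ℂ ρ s) :
    DifferentiableOn ℂ (fun w => lin α a b (ρ w)) s := by
  unfold lin; fun_prop

theorem one_zero (α : Fin 7 → ℂ) (hα : Function.Injective α) (a b x : ℂ)
    (h : ‖a‖ ^ 2 + ‖b‖ ^ 2 = 1) : ∃ i, ∀ j, j ≠ i → lin (α j) a b x ≠ 0 := by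
  by_cases h0 : ∃ i, lin (α i) a b x = 0
  · obtain ⟨i, hi⟩ := h0
    refine ⟨i, fun j hj hj0 => ?_⟩
    rw [lin_eq] at hi hj0
    set H := a - (starRingEnd ℂ) b * x with hH
    set G := b + (starRingEnd ℂ) a * x with hG
    have h1 : (α i - α j) * H = 0 := by linear_combination hj0 - hi
    have h2 : H = 0 := (mul_eq_zero.1 h1).resolve_left (sub_ne_zero.2 (fun h => hj (hα h).symm))
    have h3 : G = 0 := by rw [h2] at hi; simpa using hi
    have := frame_norm a b x h
    rw [← hH, ← hG, h2, h3] at this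
    simp at this
    nlinarith [sq_nonneg ‖x‖]
  · push Not at h0
    exact ⟨0, fun j _ => h0 j⟩

theorem loc_bd_lin {α : Fin 7 → ℂ} {a b : ℂ} {ρ : ℂ → ℂ} (T : Trip α a b ρ) (i : Fin 7)
    {w : ℂ} (hw : w ∈ ball (0:ℂ) (1 / 8)) :
    ∃ C : ℝ, 0 ≤ C ∧ ∀ᶠ z in 𝓝 w, ‖deriv ρ z‖ ^ 2 ≤ C * ‖lin (α i) a b (ρ z)‖ := by
  have hn := isOpen_ball.mem_nhds hw
  set A := (starRingEnd ℂ) a + α i * (starRingEnd ℂ) b with hAd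
  have hder : ∀ z ∈ ball (0:ℂ) (1 / 8), HasDerivAt (fun z => lin (α i) a b (ρ z)) (A * deriv ρ z) z := by
    intro z hz
    exact ((T.diff.differentiableAt (isOpen_ball.mem_nhds hz)).hasDerivAt.const_mul A).const_add _
  by_cases hA : A = 0
  · have h1 := AB_norm (α i) a b T.unit
    rw [← hAd, hA] at h1
    have hB : b - α i * a ≠ 0 := by
      intro h; rw [h] at h1; simp at h1; nlinarith [sq_nonneg ‖α i‖]
    have hBp := norm_pos_iff.2 hB
    have hl : ∀ z, lin (α i) a b (ρ z) = b - α i * a := by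
      intro z; unfold lin; rw [← hAd, hA]; simp
    have hc : ContinuousAt (fun z => ‖deriv ρ z‖ ^ 2) w :=
      (((T.diff.deriv isOpen_ball).continuousOn.continuousAt hn).norm.pow 2)
    refine ⟨(‖deriv ρ w‖ ^ 2 + 1) / ‖b - α i * a‖, by positivity, ?_⟩
    filter_upwards [hc.eventually (gt_mem_nhds (lt_add_one _))] with z hz
    rw [hl, div_mul_cancel₀ _ hBp.ne']
    exact hz.le
  · obtain ⟨C, hC0, hC⟩ := loc_bd (u := fun z => lin (α i) a b (ρ z)) (w := w)
      (ana_of_diff (lin_cont T.diff) w hw)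
      (by intro h; rw [(hder w hw).deriv, T.mult i w hw h, mul_zero])
    have hAp := norm_pos_iff.2 hA
    refine ⟨C / ‖A‖ ^ 2, by positivity, ?_⟩
    filter_upwards [hC, hn] with z hz hzb
    rw [(hder z hzb).deriv, norm_mul, mul_pow] at hz
    rw [div_mul_eq_mul_div, le_div_iff₀ (by positivity)]
    linarith

theorem trip_quot {α : Fin 7 → ℂ} (hα : Function.Injective α) {a b : ℂ} {ρ : ℂ → ℂ}
    (T : Trip α a b ρ) (hne : ∃ w ∈ ball (0:ℂ) (1 / 8), deriv ρ w ≠ 0) :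
    ∃ Q : ℂ → ℂ, DifferentiableOn ℂ Q (ball 0 (1 / 8)) ∧
      (∃ w ∈ ball (0:ℂ) (1 / 8), NN α a b (ρ w) (deriv ρ w) ≠ 0) ∧
      (∀ w ∈ ball (0:ℂ) (1 / 8), NN α a b (ρ w) (deriv ρ w) ≠ 0 →
        NN α a b (ρ w) (deriv ρ w) = ‖Q w‖ * Real.sqrt (1 + ‖ρ w‖ ^ 2)) ∧
      (∀ M : ℝ, (∀ w ∈ ball (0:ℂ) (1 / 8), NN α a b (ρ w) (deriv ρ w) ≤ M) →
        ∀ w ∈ ball (0:ℂ) (1 / 8), ‖Q w‖ * Real.sqrt (1 + ‖ρ w‖ ^ 2) ≤ M) := by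
  set P : ℂ → ℂ := fun w => ∏ j, lin (α j) a b (ρ w) with hP
  have hPd : DifferentiableOn ℂ P (ball 0 (1 / 8)) := by
    rw [hP]
    apply DifferentiableOn.fun_finsetProd
    intro j _
    exact lin_cont T.diff
  have hρ' := T.diff.deriv isOpen_ball
  have hPz : ∀ w ∈ ball (0:ℂ) (1 / 8), deriv ρ w ≠ 0 → P w ≠ 0 := by
    intro w hw hd h0
    obtain ⟨j, -, hj⟩ := Finset.prod_eq_zero_iff.1 h0
    exact hd (T.mult j w hw hj)
  have hPne : ∃ w ∈ ball (0:ℂ) (1 / 8), P w ≠ 0 := by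
    obtain ⟨w, hw, hd⟩ := hne
    exact ⟨w, hw, hPz w hw hd⟩
  have hNP : ∀ w, ‖P w‖ = ∏ j, ‖lin (α j) a b (ρ w)‖ := by intro w; rw [hP]; simp [norm_prod]
  have hNN : ∀ w, NN α a b (ρ w) (deriv ρ w) = ‖deriv ρ w ^ 2 / P w‖ * Real.sqrt (1 + ‖ρ w‖ ^ 2) := by
    intro w; unfold NN; rw [← hNP, norm_div, norm_pow]; ring
  obtain ⟨Q, hQ, hQe, hQl⟩ := quot (f := fun z => deriv ρ z ^ 2) (g := P) (hρ'.pow 2) hPd hPne (by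
    intro w hw
    obtain ⟨i, hi⟩ := one_zero α hα a b (ρ w) T.unit
    obtain ⟨C, hC0, hC⟩ := loc_bd_lin T i hw
    have hRd : DifferentiableOn ℂ (fun w => ∏ j ∈ Finset.univ.erase i, lin (α j) a b (ρ w)) (ball 0 (1 / 8)) := by
      apply DifferentiableOn.fun_finsetProd
      intro j _
      exact lin_cont T.diff
    have hR0 : ∏ j ∈ Finset.univ.erase i, lin (α j) a b (ρ w) ≠ 0 := by
      rw [Finset.prod_ne_zero_iff]
      intro j hj
      exact hi j (Finset.ne_of_mem_erase hj)
    have hRp := norm_pos_iff.2 hR0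
    have hRc := (hRd.continuousOn.continuousAt (isOpen_ball.mem_nhds hw)).norm
    refine ⟨C / (‖∏ j ∈ Finset.univ.erase i, lin (α j) a b (ρ w)‖ / 2), ?_⟩
    filter_upwards [hC, hRc.eventually (lt_mem_nhds (half_lt_self hRp))] with z h1 h2
    have h3 : ‖P z‖ = ‖lin (α i) a b (ρ z)‖ * ‖∏ j ∈ Finset.univ.erase i, lin (α j) a b (ρ z)‖ := by
      rw [← norm_mul, Finset.mul_prod_erase Finset.univ (fun j => lin (α j) a b (ρ z)) (Finset.mem_univ i)]
    rw [norm_pow, h3, div_mul_eq_mul_div, le_div_iff₀ (by positivity)]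
    calc _ ≤ (C * ‖lin (α i) a b (ρ z)‖) * ‖∏ j ∈ Finset.univ.erase i, lin (α j) a b (ρ z)‖ := by
          gcongr
      _ = _ := by ring)
  refine ⟨Q, hQ, ?_, ?_, ?_⟩
  · obtain ⟨w, hw, hd⟩ := hne
    refine ⟨w, hw, ?_⟩
    rw [hNN]
    have := hPz w hw hd
    have h1 : 0 < Real.sqrt (1 + ‖ρ w‖ ^ 2) := Real.sqrt_pos.2 (by positivity)
    have h2 : ‖deriv ρ w ^ 2 / P w‖ ≠ 0 := norm_ne_zero_iff.2 (div_ne_zero (pow_ne_zero _ hd) this)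
    positivity
  · intro w hw h
    rw [hNN] at h ⊢
    have hPw : P w ≠ 0 := by
      intro h0; rw [h0] at h; simp at h
    have := hQe w hw
    rw [this]
    field_simp
  · intro M hM w hw
    have hcρ : ContinuousAt (fun z => Real.sqrt (1 + ‖ρ z‖ ^ 2)) w := by
      have := T.diff.continuousOn.continuousAt (isOpen_ball.mem_nhds hw)
      fun_prop
    have ht : Tendsto (fun z => ‖deriv ρ z ^ 2 / P z‖ * Real.sqrt (1 + ‖ρ z‖ ^ 2)) (𝓝[≠] w)
        (𝓝 (‖Q w‖ * Real.sqrt (1 + ‖ρ w‖ ^ 2))) :=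
      (hQl w hw).norm.mul (hcρ.tendsto.mono_left nhdsWithin_le_nhds)
    apply le_of_tendsto ht
    filter_upwards [nhdsWithin_le_nhds (isOpen_ball.mem_nhds hw)] with z hz
    rw [← hNN]
    exact hM z hz

theorem abstract_thm (α : Fin 7 → ℂ) (hα : Function.Injective α)
    (S : ℂ → ℂ → (ℂ → ℂ) → Prop)
    (hT : ∀ a b ρ, S a b ρ → Trip α a b ρ)
    (hne : ∀ a b ρ, S a b ρ → ∃ w ∈ ball (0:ℂ) (1 / 8), deriv ρ w ≠ 0)
    (hrec : ∀ a b ρ, S a b ρ → ∀ w ∈ ball (0:ℂ) (1 / 8), NN α a b (ρ w) (deriv ρ w) ≠ 0 →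
      ∃ a2 b2 ρ2, S a2 b2 ρ2 ∧ NN α a2 b2 0 (deriv ρ2 0) = NN α a b (ρ w) (deriv ρ w))
    (hex : ∃ a b ρ, S a b ρ) : False := by
  obtain ⟨C, hC0, hX⟩ := lemX α hα
  set V : Set ℝ := {v | ∃ a b ρ, S a b ρ ∧ v = NN α a b 0 (deriv ρ 0)} with hV
  have hVb : BddAbove V := by
    refine ⟨C, ?_⟩
    rintro v ⟨a, b, ρ, hS, rfl⟩
    have T := hT a b ρ hS
    have := hX a b ρ T 1 le_rfl (fun w hw => T.bd w (ball_subset_ball (by norm_num) hw))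
    linarith
  set M := sSup V with hM
  have hMN : ∀ a b ρ, S a b ρ → ∀ w ∈ ball (0:ℂ) (1 / 8), NN α a b (ρ w) (deriv ρ w) ≠ 0 →
      NN α a b (ρ w) (deriv ρ w) ≤ M := by
    intro a b ρ hS w hw h
    obtain ⟨a2, b2, ρ2, hS2, h2⟩ := hrec a b ρ hS w hw h
    rw [← h2]
    exact le_csSup hVb ⟨a2, b2, ρ2, hS2, rfl⟩
  have hMpos : 0 < M := by
    obtain ⟨a, b, ρ, hS⟩ := hex
    obtain ⟨Q, -, ⟨w, hw, h⟩, -⟩ := trip_quot hα (hT a b ρ hS) (hne a b ρ hS)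
    exact lt_of_lt_of_le (lt_of_le_of_ne (NN_nonneg _ _ _ _ _) h.symm) (hMN a b ρ hS w hw h)
  have hMN' : ∀ a b ρ, S a b ρ → ∀ w ∈ ball (0:ℂ) (1 / 8), NN α a b (ρ w) (deriv ρ w) ≤ M := by
    intro a b ρ hS w hw
    by_cases h : NN α a b (ρ w) (deriv ρ w) = 0
    · rw [h]; exact hMpos.le
    · exact hMN a b ρ hS w hw h
  have hVne : V.Nonempty := by
    obtain ⟨a, b, ρ, hS⟩ := hex
    exact ⟨_, a, b, ρ, hS, rfl⟩
  have hpick : ∀ k : ℕ, ∃ a b ρ, S a b ρ ∧ M - M / (k + 2) < NN α a b 0 (deriv ρ 0) := by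
    intro k
    obtain ⟨v, ⟨a, b, ρ, hS, rfl⟩, hv⟩ := exists_lt_of_lt_csSup hVne
      (show M - M / ((k:ℝ) + 2) < sSup V by rw [← hM]; have : 0 < M / ((k:ℝ) + 2) := by positivity
                                            linarith)
    exact ⟨a, b, ρ, hS, hv⟩
  choose a b ρ hS hk using hpick
  have hpos : ∀ k, 0 < NN (α) (a k) (b k) 0 (deriv (ρ k) 0) := by
    intro k
    refine lt_of_le_of_lt ?_ (hk k)
    have : M / ((k:ℝ) + 2) ≤ M := div_le_self hMpos.le (by have : (0:ℝ) ≤ k := by positivity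
                                                           linarith)
    linarith
  have hq := fun k => trip_quot hα (hT _ _ _ (hS k)) (hne _ _ _ (hS k))
  choose Q hQd _ hQN hQM using hq
  have h0b : (0:ℂ) ∈ ball (0:ℂ) (1 / 8) := mem_ball_self (by norm_num)
  have hz : ∀ k, ρ k 0 = 0 := fun k => (hT _ _ _ (hS k)).zero
  have hQ0 : ∀ k, NN α (a k) (b k) 0 (deriv (ρ k) 0) = ‖Q k 0‖ := by
    intro k
    have := hQN k 0 h0b
    rw [hz k] at this
    rw [this (hpos k).ne']
    simp
  have hQb : ∀ k, ∀ w ∈ ball (0:ℂ) (1 / 8), ‖Q k w‖ * Real.sqrt (1 + ‖ρ k w‖ ^ 2) ≤ M :=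
    fun k => hQM k M (hMN' _ _ _ (hS k))
  have hsq : ∀ x : ℝ, 1 ≤ Real.sqrt (1 + x ^ 2) := by
    intro x; rw [Real.one_le_sqrt]; nlinarith [sq_nonneg x]
  have hQb' : ∀ k, ∀ w ∈ ball (0:ℂ) (1 / 8), ‖Q k w‖ ≤ M := by
    intro k w hw
    have h1 := hQb k w hw
    have h2 := hsq ‖ρ k w‖
    nlinarith [norm_nonneg (Q k w)]
  set U : Ultrafilter ℕ := hyperfilter ℕ with hU
  obtain ⟨QQ, hQQd, hQQc, -, -⟩ := ultra_montel U Q (1 / 8) M (Eventually.of_forall hQd)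
    (Eventually.of_forall hQb')
  obtain ⟨RR, hRRd, hRRc, -, -⟩ := ultra_montel U ρ (1 / 8) 1
    (Eventually.of_forall fun k => (hT _ _ _ (hS k)).diff)
    (Eventually.of_forall fun k => (hT _ _ _ (hS k)).bd)
  have hlim : ∀ w ∈ ball (0:ℂ) (1 / 8), ‖QQ w‖ * Real.sqrt (1 + ‖RR w‖ ^ 2) ≤ M := by
    intro w hw
    have h1 := (hQQc.at hw).norm
    have h2 := (Real.continuous_sqrt.tendsto _).comp ((((hRRc.at hw).norm).pow 2).const_add 1)
    exact le_of_tendsto (h1.mul h2) (Eventually.of_forall fun k => hQb k w hw)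
  have hUle : (U : Filter ℕ) ≤ atTop := by
    rw [hU, ← Nat.cofinite_eq_atTop]; exact hyperfilter_le_cofinite
  have hto : Tendsto (fun k => NN α (a k) (b k) 0 (deriv (ρ k) 0)) U (𝓝 M) := by
    have h1 : Tendsto (fun k : ℕ => M - M / ((k:ℝ) + 2)) atTop (𝓝 M) := by
      have h2 : Tendsto (fun k : ℕ => M / ((k:ℝ) + 2)) atTop (𝓝 0) :=
        (tendsto_const_nhds).div_atTop
          ((tendsto_natCast_atTop_atTop).atTop_add tendsto_const_nhds)
      simpa using (tendsto_const_nhds (x := M)).sub h2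
    refine tendsto_of_tendsto_of_tendsto_of_le_of_le (h1.mono_left hUle) tendsto_const_nhds
      (fun k => (hk k).le) (fun k => le_csSup hVb ⟨_, _, _, hS k, rfl⟩)
  have hQQ0 : ‖QQ 0‖ = M := by
    have h1 := (hQQc.at h0b).norm
    simp only [hQ0] at hto
    exact tendsto_nhds_unique h1 hto
  have hmax : IsMaxOn (norm ∘ QQ) (ball (0:ℂ) (1 / 8)) 0 := by
    intro w hw
    show ‖QQ w‖ ≤ ‖QQ 0‖
    rw [hQQ0]
    have h1 := hlim w hw
    have h2 := hsq ‖RR w‖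
    nlinarith [norm_nonneg (QQ w)]
  have hconst := Complex.norm_eqOn_of_isPreconnected_of_isMaxOn
    (convex_ball (0:ℂ) (1 / 8)).isPreconnected isOpen_ball hQQd h0b hmax
  have hR0 : ∀ w ∈ ball (0:ℂ) (1 / 8), RR w = 0 := by
    intro w hw
    have h1 := hlim w hw
    have h2 : ‖QQ w‖ = M := (hconst hw).trans hQQ0
    rw [h2] at h1
    have h3 : Real.sqrt (1 + ‖RR w‖ ^ 2) ≤ 1 := by
      by_contra h; push Not at h; nlinarith
    rw [Real.sqrt_le_one] at h3
    have : ‖RR w‖ ^ 2 ≤ 0 := by linarith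
    have h5 : ‖RR w‖ = 0 := by nlinarith [norm_nonneg (RR w)]
    exact norm_eq_zero.1 h5
  have htl := tlu_of_CC isOpen_ball hRRd.continuousOn hRRc
  have hun := (tendstoLocallyUniformlyOn_iff_forall_isCompact isOpen_ball).1 htl
    (closedBall 0 (1 / 16)) (closedBall_subset_ball (by norm_num)) (isCompact_closedBall _ _)
  set η : ℝ := min 1 (M / (2 * (C + 1))) with hη
  have hηp : 0 < η := by positivity
  have h1 := Metric.tendstoUniformlyOn_iff.1 hun η hηp
  have h2 : ∀ᶠ k in (U : Filter ℕ), NN α (a k) (b k) 0 (deriv (ρ k) 0) ≤ M / 2 := by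
    filter_upwards [h1] with k hk
    have := hX _ _ _ (hT _ _ _ (hS k)) η (min_le_left _ _) (by
      intro w hw
      have := hk w (ball_subset_closedBall hw)
      rw [hR0 w (ball_subset_ball (by norm_num) hw), dist_zero_left] at this
      exact this.le)
    refine this.trans ?_
    calc C * η ≤ (C + 1) * (M / (2 * (C + 1))) := by
          gcongr
          · linarith
          · exact min_le_right _ _
      _ = M / 2 := by field_simp
  have := le_of_tendsto hto h2
  linarith

end Isl


namespace Isl
open Set Metric Filter Topology

/-- `y` can be reached from `x` by a C¹ path in `Ω` of speed at most `l`. -/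
def Step (Ω : Set ℂ) (lam : ℂ → ℝ) (l : ℝ) (x y : ℂ) : Prop :=
  ∃ p p' : ℝ → ℂ, (∀ t ∈ Icc (0:ℝ) 1, HasDerivAt p (p' t) t ∧ p t ∈ Ω ∧ lam (p t) * ‖p' t‖ ≤ l) ∧
    ContinuousOn p' (Icc 0 1) ∧ p 0 = x ∧ p 1 = y

theorem esc {lam : ℂ → ℝ} {p p' : ℝ → ℂ} {l m δ t0 : ℝ} (ht0 : t0 ∈ Icc (0:ℝ) 1)
    (hp : ∀ t ∈ Icc (0:ℝ) 1, HasDerivAt p (p' t) t ∧ lam (p t) * ‖p' t‖ < l)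
    (hm : 0 < m) (hδ : 0 < δ) (hlam : ∀ z ∈ ball (p t0) δ, m ≤ lam z) (hl : l / m < δ) :
    ‖p 1 - p t0‖ ≤ l / m := by
  have hl0 : 0 ≤ l / m := by
    have h1 := (hp t0 ht0).2
    have h3 := hlam (p t0) (mem_ball_self hδ)
    have : 0 ≤ lam (p t0) * ‖p' t0‖ := mul_nonneg (by linarith) (norm_nonneg _)
    apply div_nonneg _ hm.le; linarith
  have key := image_norm_le_of_norm_deriv_right_lt_deriv_boundary (f := fun t => p t - p t0)
    (f' := p') (a := t0) (b := 1) (B := fun t => l / m * (t - t0)) (B' := fun _ => l / m)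
    (by
      intro t ht
      exact (((hp t ⟨ht0.1.trans ht.1, ht.2⟩).1).continuousAt.sub continuousAt_const).continuousWithinAt)
    (by
      intro t ht
      exact ((hp t ⟨ht0.1.trans ht.1, ht.2.le⟩).1.sub_const _).hasDerivWithinAt)
    (by simp)
    (by intro t; simpa using ((hasDerivAt_id t).sub_const t0).const_mul (l / m))
    (by
      intro t ht he
      have h1 := hp t ⟨ht0.1.trans ht.1, ht.2.le⟩
      have h2 : p t ∈ ball (p t0) δ := by
        rw [mem_ball, dist_eq_norm, he]
        have : t - t0 ≤ 1 := by linarith [ht.2, ht0.1]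
        nlinarith
      have h3 := hlam _ h2
      rw [lt_div_iff₀ hm]
      nlinarith [norm_nonneg (p' t)])
  have := key (x := 1) ⟨ht0.2, le_rfl⟩
  refine this.trans ?_
  have : 1 - t0 ≤ 1 := by linarith [ht0.1]
  nlinarith


/-- Concatenation of paths. -/
noncomputable def cat (p : ℕ → ℝ → ℂ) (s : ℝ) : ℂ := p ⌊s⌋₊ (s - ⌊s⌋₊)

theorem cat_eq {p : ℕ → ℝ → ℂ} (hj : ∀ i, p i 1 = p (i + 1) 0) (i : ℕ) {s : ℝ}
    (hs : s ∈ Icc (i:ℝ) (i + 1)) : cat p s = p i (s - i) := by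
  rcases hs.2.eq_or_lt with h | h
  · have : ⌊s⌋₊ = i + 1 := by
      rw [h]; exact_mod_cast Nat.floor_natCast (R := ℝ) (i + 1)
    unfold cat
    rw [this, h]
    push_cast
    simp [hj]
  · have : ⌊s⌋₊ = i := by
      rw [Nat.floor_eq_iff (le_trans (by positivity) hs.1)]
      exact ⟨hs.1, h⟩
    unfold cat
    rw [this]

theorem cat_cont {p : ℕ → ℝ → ℂ} (hj : ∀ i, p i 1 = p (i + 1) 0)
    (hc : ∀ i, ContinuousOn (p i) (Icc 0 1)) : ContinuousOn (cat p) (Ici 0) := by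
  have h1 : ∀ i : ℕ, ContinuousOn (cat p) (Icc (i:ℝ) (i + 1)) := by
    intro i
    have : ContinuousOn (fun s : ℝ => p i (s - i)) (Icc (i:ℝ) (i + 1)) := by
      apply (hc i).comp (by fun_prop)
      intro s hs
      exact ⟨by linarith [hs.1], by linarith [hs.2]⟩
    exact this.congr (fun s hs => cat_eq hj i hs)
  have h2 : ∀ n : ℕ, ContinuousOn (cat p) (Icc (0:ℝ) n) := by
    intro n
    induction n with
    | zero => simp
    | succ n ih =>
      have := ih.union_of_isClosed (h1 n) isClosed_Icc isClosed_Icc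
      rw [Icc_union_Icc_eq_Icc (by positivity) (by linarith)] at this
      exact_mod_cast this
  intro s hs
  obtain ⟨n, hn⟩ := exists_nat_gt s
  have := h2 n s ⟨hs, hn.le⟩
  apply this.mono_of_mem_nhdsWithin
  have h3 : Iio (n:ℝ) ∈ 𝓝 s := Iio_mem_nhds hn
  filter_upwards [self_mem_nhdsWithin, nhdsWithin_le_nhds h3] with x hx hx2
  exact ⟨hx, le_of_lt hx2⟩

theorem sig_hasDeriv {t : ℝ} (ht : t < 1) : HasDerivAt (fun t : ℝ => t / (1 - t)) (1 / (1 - t) ^ 2) t := by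
  have h1 : (1 - t) ≠ 0 := by linarith
  have := (hasDerivAt_id t).div ((hasDerivAt_const t (1:ℝ)).sub (hasDerivAt_id t)) h1
  have e : (1 / (1 - t) ^ 2) = (1 * (1 - id t) - id t * (0 - 1)) / (1 - id t) ^ 2 := by
    simp
  rw [e]
  exact this

/-- If steps have summable lengths then a complete metric forces a late visit to a compact set. -/
theorem late_visit {Ω : Set ℂ} {lam : ℂ → ℝ} (hcomp : MetricComplete Ω lam)
    {p p' : ℕ → ℝ → ℂ} {l : ℕ → ℝ}
    (hp : ∀ i, ∀ t ∈ Icc (0:ℝ) 1, HasDerivAt (p i) (p' i t) t ∧ p i t ∈ Ω ∧ lam (p i t) * ‖p' i t‖ ≤ l i)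
    (hp' : ∀ i, ContinuousOn (p' i) (Icc 0 1)) (hj : ∀ i, p i 1 = p (i + 1) 0)
    (hl0 : ∀ i, 0 ≤ l i) (hl : Summable l) :
    ∃ K ⊆ Ω, IsCompact K ∧ ∀ N : ℕ, ∃ i ≥ N, ∃ t ∈ Icc (0:ℝ) 1, p i t ∈ K := by
  by_contra hcon
  push Not at hcon
  set σ : ℝ → ℝ := fun t => t / (1 - t) with hσ
  set γ : ℝ → ℂ := fun t => cat p (σ t) with hγ
  set γ' : ℝ → ℂ := fun t => ((1 / (1 - t) ^ 2 : ℝ) : ℂ) * cat p' (σ t) with hγ'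
  have hσ0 : ∀ t ∈ Ico (0:ℝ) 1, 0 ≤ σ t := fun t ht => div_nonneg ht.1 (by linarith [ht.2])
  have hfl : ∀ s : ℝ, 0 ≤ s → s - ⌊s⌋₊ ∈ Icc (0:ℝ) 1 := by
    intro s hs
    exact ⟨by linarith [Nat.floor_le hs], by linarith [Nat.lt_floor_add_one s]⟩
  have hin : ∀ t ∈ Ico (0:ℝ) 1, γ t ∈ Ω := by
    intro t ht
    exact (hp _ _ (hfl _ (hσ0 t ht))).2.1
  have hσc : ∀ t ∈ Ico (0:ℝ) 1, ContinuousAt σ t := fun t ht => (sig_hasDeriv ht.2).continuousAt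
  have hpc : PiecewiseC1 γ γ' := by
    refine ⟨?_, {t | ∃ i : ℕ, σ t = i}, ?_, ?_, ?_⟩
    · apply (cat_cont hj (fun i t ht => (hp i t ht).1.continuousAt.continuousWithinAt)).comp
        (fun t ht => (hσc t ht).continuousWithinAt)
      exact fun t ht => hσ0 t ht
    · intro b hb
      obtain ⟨N, hN⟩ := exists_nat_gt (b / (1 - b))
      apply ((Finset.range N).finite_toSet.image (fun i : ℕ => (i:ℝ) / (i + 1))).subset
      rintro t ⟨⟨i, hi⟩, ht⟩
      have ht1 : 0 < 1 - t := by linarith [ht.2]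
      refine ⟨i, ?_, ?_⟩
      · simp only [Finset.coe_range, mem_Iio]
        have h1 : (i:ℝ) < N := by
          rw [← hi]
          refine lt_of_le_of_lt ?_ hN
          have : 0 < 1 - b := by linarith
          simp only [hσ]
          rw [div_le_div_iff₀ ht1 this]
          nlinarith [ht.2]
        exact_mod_cast h1
      · simp only [hσ] at hi
        show (i:ℝ) / (i + 1) = t
        rw [← hi]; field_simp; ring
    · intro t ht
      have hne : (⌊σ t⌋₊ : ℝ) ≠ σ t := fun h => ht.2 ⟨_, h.symm⟩
      set i := ⌊σ t⌋₊ with hi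
      have h1 : (i:ℝ) < σ t := lt_of_le_of_ne (Nat.floor_le (hσ0 t ht.1)) hne
      have h2 : σ t < i + 1 := Nat.lt_floor_add_one _
      have hev : γ =ᶠ[𝓝 t] fun t => p i (σ t - i) := by
        filter_upwards [(hσc t ht.1).eventually (Ioo_mem_nhds h1 h2)] with x hx
        exact cat_eq hj i ⟨hx.1.le, hx.2.le⟩
      have hd : HasDerivAt (fun t => p i (σ t - i)) ((1 / (1 - t) ^ 2) • p' i (σ t - i)) t := by
        have h3 := (hp i (σ t - i) ⟨by linarith, by linarith⟩).1
        exact h3.scomp t ((sig_hasDeriv ht.1.2).sub_const (i:ℝ))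
      have := hd.congr_of_eventuallyEq hev
      have e : γ' t = (1 / (1 - t) ^ 2) • p' i (σ t - i) := by
        simp only [hγ', cat, ← hi]
        rw [Complex.real_smul]
      rw [e]
      exact this
    · intro t ht
      apply ContinuousAt.continuousWithinAt
      have hne : (⌊σ t⌋₊ : ℝ) ≠ σ t := fun h => ht.2 ⟨_, h.symm⟩
      set i := ⌊σ t⌋₊ with hi
      have h1 : (i:ℝ) < σ t := lt_of_le_of_ne (Nat.floor_le (hσ0 t ht.1)) hne
      have h2 : σ t < i + 1 := Nat.lt_floor_add_one _
      have hev : γ' =ᶠ[𝓝 t] fun t => ((1 / (1 - t) ^ 2 : ℝ) : ℂ) * p' i (σ t - i) := by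
        filter_upwards [(hσc t ht.1).eventually (Ioo_mem_nhds h1 h2)] with x hx
        have : ⌊σ x⌋₊ = i := by
          rw [Nat.floor_eq_iff (le_trans (by positivity) hx.1.le)]
          exact ⟨hx.1.le, hx.2⟩
        simp only [hγ', cat, this]
      rw [continuousAt_congr hev]
      have h3 : ContinuousAt (p' i) (σ t - i) :=
        (hp' i).continuousAt (Icc_mem_nhds (by linarith) (by linarith))
      have h4 : ContinuousAt (fun t => p' i (σ t - i)) t :=
        ContinuousAt.comp (f := fun t => σ t - i) h3 ((hσc t ht.1).sub continuousAt_const)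
      have h5 : ContinuousAt (fun t : ℝ => 1 / (1 - t) ^ 2) t := by
        have : (1 - t) ^ 2 ≠ 0 := pow_ne_zero _ (by linarith [ht.1.2])
        fun_prop (disch := assumption)
      exact (Complex.continuous_ofReal.continuousAt.comp h5).mul h4
  have hdiv : DivergentPath Ω γ := by
    intro K hK hKc
    obtain ⟨N, hN⟩ := hcon K hK hKc
    refine ⟨(N:ℝ) / (N + 1), ⟨by positivity, by rw [div_lt_one (by positivity)]; linarith⟩, ?_⟩
    intro t h1 h2
    have hN0 : (0:ℝ) ≤ (N:ℝ) / (N + 1) := by positivity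
    have ht : t ∈ Ico (0:ℝ) 1 := ⟨by linarith, h2⟩
    refine hN _ ?_ _ (hfl _ (hσ0 t ht))
    apply Nat.le_floor
    simp only [hσ]
    rw [le_div_iff₀ (by linarith)]
    rw [div_lt_iff₀ (by positivity)] at h1
    nlinarith
  have htop := hcomp γ γ' hin hpc hdiv
  have hcover : Ico (0:ℝ) 1 ⊆ ⋃ i : ℕ, Ico ((i:ℝ) / (i + 1)) ((i + 1) / (i + 2)) := by
    intro t ht
    have ht1 : 0 < 1 - t := by linarith [ht.2]
    rw [mem_iUnion]
    refine ⟨⌊σ t⌋₊, ?_⟩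
    have h1 := Nat.floor_le (hσ0 t ht)
    have h2 := Nat.lt_floor_add_one (σ t)
    set i : ℝ := (⌊σ t⌋₊ : ℝ) with hi
    have hi0 : 0 ≤ i := by positivity
    simp only [hσ] at h1 h2
    rw [le_div_iff₀ ht1] at h1
    rw [div_lt_iff₀ ht1] at h2
    constructor
    · rw [div_le_iff₀ (by positivity)]; nlinarith
    · rw [lt_div_iff₀ (by positivity)]; nlinarith
  have hpiece : ∀ i : ℕ, ∫⁻ t in Ico ((i:ℝ) / (i + 1)) ((i + 1) / (i + 2)),
      ENNReal.ofReal (lam (γ t) * ‖γ' t‖) ≤ ENNReal.ofReal (2 * l i) := by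
    intro i
    have hi0 : (0:ℝ) ≤ i := by positivity
    calc _ ≤ ∫⁻ t in Ico ((i:ℝ) / (i + 1)) ((i + 1) / (i + 2)), ENNReal.ofReal (l i * (i + 2) ^ 2) := by
          apply setLIntegral_mono measurable_const
          intro t ht
          apply ENNReal.ofReal_le_ofReal
          have hub : t < 1 := ht.2.trans_le (by rw [div_le_one (by positivity)]; linarith)
          have hlb : 0 ≤ t := le_trans (by positivity) ht.1
          have ht1 : 0 < 1 - t := by linarith
          have h1 : (i:ℝ) ≤ σ t := by
            simp only [hσ]; rw [le_div_iff₀ ht1]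
            have := ht.1; rw [div_le_iff₀ (by positivity)] at this; nlinarith
          have h2 : σ t < i + 1 := by
            simp only [hσ]; rw [div_lt_iff₀ ht1]
            have := ht.2; rw [lt_div_iff₀ (by positivity)] at this; nlinarith
          have hfi : ⌊σ t⌋₊ = i := by
            rw [Nat.floor_eq_iff (hσ0 t ⟨hlb, hub⟩)]
            exact ⟨h1, h2⟩
          have h3 := (hp i (σ t - i) ⟨by linarith, by linarith⟩).2.2
          have e1 : lam (γ t) * ‖γ' t‖ = (1 / (1 - t) ^ 2) * (lam (p i (σ t - i)) * ‖p' i (σ t - i)‖) := by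
            simp only [hγ, hγ', cat, hfi, norm_mul, Complex.norm_real]
            rw [Real.norm_of_nonneg (by positivity)]
            ring
          have e2 : 1 / (1 - t) ^ 2 ≤ (i + 2 : ℝ) ^ 2 := by
            have h4 : 1 / (1 - t) ≤ (i + 2 : ℝ) := by
              rw [div_le_iff₀ ht1]
              have := ht.2; rw [lt_div_iff₀ (by positivity)] at this; nlinarith
            calc 1 / (1 - t) ^ 2 = (1 / (1 - t)) ^ 2 := by rw [div_pow, one_pow]
              _ ≤ _ := by gcongr
          rw [e1]
          calc _ ≤ (1 / (1 - t) ^ 2) * l i := by gcongr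
            _ ≤ (i + 2 : ℝ) ^ 2 * l i := by gcongr; exact hl0 i
            _ = _ := by ring
      _ = ENNReal.ofReal (l i * (i + 2) ^ 2) * ENNReal.ofReal (((i:ℝ) + 1) / (i + 2) - (i:ℝ) / (i + 1)) := by
          rw [setLIntegral_const, Real.volume_Ico]
      _ ≤ _ := by
          rw [← ENNReal.ofReal_mul (by have := hl0 i; positivity)]
          apply ENNReal.ofReal_le_ofReal
          have : l i * (i + 2) ^ 2 * (((i:ℝ) + 1) / (i + 2) - (i:ℝ) / (i + 1)) = l i * ((i + 2) / (i + 1)) := by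
            field_simp; ring
          rw [this]
          have h2 : ((i:ℝ) + 2) / (i + 1) ≤ 2 := by rw [div_le_iff₀ (by positivity)]; linarith
          nlinarith [hl0 i]
  have hfin : ∫⁻ t in Ico (0:ℝ) 1, ENNReal.ofReal (lam (γ t) * ‖γ' t‖) < ⊤ := by
    calc _ ≤ ∫⁻ t in ⋃ i : ℕ, Ico ((i:ℝ) / (i + 1)) ((i + 1) / (i + 2)), ENNReal.ofReal (lam (γ t) * ‖γ' t‖) :=
          lintegral_mono_set hcover
      _ ≤ ∑' i : ℕ, ∫⁻ t in Ico ((i:ℝ) / (i + 1)) ((i + 1) / (i + 2)), ENNReal.ofReal (lam (γ t) * ‖γ' t‖) :=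
          lintegral_iUnion_le _ _
      _ ≤ ∑' i : ℕ, ENNReal.ofReal (2 * l i) := ENNReal.tsum_le_tsum hpiece
      _ < ⊤ := by
          have := (hl.mul_left 2).tsum_ofReal_ne_top
          exact this.lt_top
  exact hfin.ne htop

theorem complete_lim {Ω : Set ℂ} (hΩ : IsOpen Ω) {lam : ℂ → ℝ} (hcomp : MetricComplete Ω lam)
    (hlamc : ContinuousOn lam Ω) (hlamp : ∀ z ∈ Ω, 0 < lam z) {y : ℕ → ℂ} {l : ℕ → ℝ}
    (hs : ∀ i, Step Ω lam (l i) (y i) (y (i + 1))) (hl : Summable l) :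
    ∃ z ∈ Ω, Tendsto y atTop (𝓝 z) := by
  choose p p' hp hp' h0 h1 using hs
  set l' : ℕ → ℝ := fun i => l i + (1 / 2) ^ i with hl'
  have hl's : Summable l' := hl.add summable_geometric_two
  have hl0 : ∀ i, 0 ≤ l i := by
    intro i
    have := hp i 0 ⟨le_rfl, zero_le_one⟩
    exact (mul_nonneg (hlamp _ this.2.1).le (norm_nonneg _)).trans this.2.2
  have hl'p : ∀ i, l i < l' i := by
    intro i; have : (0:ℝ) < (1 / 2) ^ i := by positivity
    simp only [hl']; linarith
  have hl'0 : ∀ i, 0 ≤ l' i := fun i => (hl0 i).trans (hl'p i).le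
  obtain ⟨K, hK, hKc, hvis⟩ := late_visit hcomp hp hp' (fun i => by rw [h1, h0]) hl0 hl
  obtain ⟨δ, hδ, hδK⟩ := hKc.exists_cthickening_subset_open hΩ hK
  have hKc' : IsCompact (cthickening δ K) := hKc.cthickening
  have hKne : (cthickening δ K).Nonempty := by
    obtain ⟨i, -, t, -, hi⟩ := hvis 0
    exact ⟨_, self_subset_cthickening K hi⟩
  obtain ⟨zm, hzm, hmin⟩ := hKc'.exists_isMinOn hKne (hlamc.mono hδK)
  set m := lam zm with hm
  have hmp : 0 < m := hlamp _ (hδK hzm)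
  obtain ⟨N, hN⟩ : ∃ N : ℕ, ∀ n ≥ N, ∑' i, l' (i + n) < m * δ := by
    have := tendsto_sum_nat_add l'
    exact eventually_atTop.1 (this.eventually (gt_mem_nhds (by positivity)))
  obtain ⟨i, hi, t0, ht0, hiK⟩ := hvis N
  set x0 := p i t0 with hx0
  have hball : ∀ z ∈ ball x0 δ, m ≤ lam z := by
    intro z hz
    apply hmin
    exact thickening_subset_cthickening _ _ (mem_thickening_iff.2 ⟨x0, hiK, hz⟩)
  have hsum : ∑' k, l' (k + i) < m * δ := hN i hi
  have hsi : Summable (fun k => l' (k + i)) := (summable_nat_add_iff i).2 hl's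
  have hpart : ∀ n : ℕ, ∑ k ∈ Finset.range n, l' (k + i) < m * δ := fun n =>
    lt_of_le_of_lt (hsi.sum_le_tsum _ (fun k _ => hl'0 _)) hsum
  have hind : ∀ n : ℕ, ‖y (i + 1 + n) - x0‖ ≤ (∑ k ∈ Finset.range (n + 1), l' (k + i)) / m := by
    intro n
    induction n with
    | zero =>
      have := esc (lam := lam) (l := l' i) ht0 (fun t ht => ⟨(hp i t ht).1, (hp i t ht).2.2.trans_lt (hl'p i)⟩) hmp hδ
        hball (by rw [div_lt_iff₀ hmp]; have := hpart 1; simp at this; linarith)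
      rw [h1 i] at this
      simpa using this
    | succ n ih =>
      set j := i + 1 + n with hjd
      have e : (∑ k ∈ Finset.range (n + 1 + 1), l' (k + i)) = (∑ k ∈ Finset.range (n + 1), l' (k + i)) + l' j := by
        rw [Finset.sum_range_succ]
        congr 2; omega
      have h2 := hpart (n + 1 + 1)
      rw [e] at h2
      have h5 : l' j / m < δ - ‖y j - x0‖ := by
        have : l' j / m + (∑ k ∈ Finset.range (n + 1), l' (k + i)) / m < δ := by
          rw [← add_div, div_lt_iff₀ hmp]; linarith
        linarith
      have hb : ball (p j 0) (δ - ‖y j - x0‖) ⊆ ball x0 δ := by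
        apply ball_subset_ball'
        rw [h0 j, dist_eq_norm]; linarith
      have := esc (lam := lam) (l := l' j) (t0 := 0) ⟨le_rfl, zero_le_one⟩
        (fun t ht => ⟨(hp j t ht).1, (hp j t ht).2.2.trans_lt (hl'p j)⟩) hmp
        (lt_of_le_of_lt (div_nonneg (hl'0 j) hmp.le) h5)
        (fun z hz => hball z (hb hz)) h5
      rw [h1, h0] at this
      rw [e, add_div]
      have e3 : y (i + 1 + (n + 1)) = y (j + 1) := by congr 1
      rw [e3]
      calc ‖y (j + 1) - x0‖ = ‖(y j - x0) + (y (j + 1) - y j)‖ := by congr 1; ring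
        _ ≤ _ := norm_add_le _ _
        _ ≤ _ := add_le_add ih this
  have hdist : ∀ n : ℕ, dist (y (i + 1 + n)) (y (i + 1 + (n + 1))) ≤ l' (n + 1 + i) / m := by
    intro n
    set j := i + 1 + n with hjd
    have e : (∑ k ∈ Finset.range (n + 1 + 1), l' (k + i)) = (∑ k ∈ Finset.range (n + 1), l' (k + i)) + l' j := by
      rw [Finset.sum_range_succ]
      congr 2; omega
    have h2 := hpart (n + 1 + 1)
    have ih := hind n
    rw [e] at h2
    have h5 : l' j / m < δ - ‖y j - x0‖ := by
      have : l' j / m + (∑ k ∈ Finset.range (n + 1), l' (k + i)) / m < δ := by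
        rw [← add_div, div_lt_iff₀ hmp]; linarith
      linarith
    have hb : ball (p j 0) (δ - ‖y j - x0‖) ⊆ ball x0 δ := by
      apply ball_subset_ball'
      rw [h0 j, dist_eq_norm]; linarith
    have := esc (lam := lam) (l := l' j) (t0 := 0) ⟨le_rfl, zero_le_one⟩
      (fun t ht => ⟨(hp j t ht).1, (hp j t ht).2.2.trans_lt (hl'p j)⟩) hmp
      (lt_of_le_of_lt (div_nonneg (hl'0 j) hmp.le) h5)
      (fun z hz => hball z (hb hz)) h5
    rw [h1, h0] at this
    rw [dist_comm, dist_eq_norm]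
    have e4 : n + 1 + i = j := by omega
    rw [e4]
    exact this
  have hcau : CauchySeq (fun n => y (i + 1 + n)) := by
    apply cauchySeq_of_dist_le_of_summable _ hdist
    apply Summable.div_const
    have := (summable_nat_add_iff (i + 1)).2 hl's
    refine this.congr (fun n => ?_)
    congr 1; omega
  obtain ⟨z, hz⟩ := cauchySeq_tendsto_of_complete hcau
  refine ⟨z, ?_, ?_⟩
  · apply hδK
    apply hKc'.isClosed.mem_of_tendsto hz
    apply Eventually.of_forall
    intro n
    apply thickening_subset_cthickening
    refine mem_thickening_iff.2 ⟨x0, hiK, ?_⟩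
    rw [dist_eq_norm]
    refine lt_of_le_of_lt (hind n) ?_
    rw [div_lt_iff₀ hmp]; linarith [hpart (n + 1)]
  · have h3 : (fun n => y (i + 1 + n)) = fun n => y (n + (i + 1)) := by
      funext n; congr 1; omega
    rw [h3] at hz
    exact (tendsto_add_atTop_iff_nat (i + 1)).1 hz

end Isl


namespace Isl
open Set Metric Filter Topology

/-- `y` can be reached from `x` by `n` steps of length at most `l`. -/
def Reach (Ω : Set ℂ) (lam : ℂ → ℝ) (n : ℕ) (l : ℝ) (x y : ℂ) : Prop :=
  ∃ p : ℕ → ℂ, p 0 = x ∧ p n = y ∧ ∀ k < n, Step Ω lam l (p k) (p (k + 1))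

theorem Step.mem_right {Ω : Set ℂ} {lam : ℂ → ℝ} {l : ℝ} {x y : ℂ} (h : Step Ω lam l x y) : y ∈ Ω := by
  obtain ⟨p, p', h1, -, -, rfl⟩ := h
  exact (h1 1 ⟨zero_le_one, le_rfl⟩).2.1

theorem Step.mem_left {Ω : Set ℂ} {lam : ℂ → ℝ} {l : ℝ} {x y : ℂ} (h : Step Ω lam l x y) : x ∈ Ω := by
  obtain ⟨p, p', h1, -, rfl, -⟩ := h
  exact (h1 0 ⟨le_rfl, zero_le_one⟩).2.1

theorem step_refl {Ω : Set ℂ} {lam : ℂ → ℝ} {l : ℝ} {x : ℂ} (hx : x ∈ Ω) (hl : 0 ≤ l) :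
    Step Ω lam l x x :=
  ⟨fun _ => x, fun _ => 0, fun t _ => ⟨hasDerivAt_const _ _, hx, by simpa using hl⟩,
    continuousOn_const, rfl, rfl⟩

theorem reach_zero {Ω : Set ℂ} {lam : ℂ → ℝ} {l : ℝ} {x : ℂ} : Reach Ω lam 0 l x x :=
  ⟨fun _ => x, rfl, rfl, fun k hk => absurd hk (Nat.not_lt_zero k)⟩

theorem Reach.succ {Ω : Set ℂ} {lam : ℂ → ℝ} {n : ℕ} {l : ℝ} {x y z : ℂ} (h : Reach Ω lam n l x y)
    (hs : Step Ω lam l y z) : Reach Ω lam (n + 1) l x z := by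
  obtain ⟨p, h0, hn, hp⟩ := h
  refine ⟨fun k => if k ≤ n then p k else z, by simpa using h0, by simp, ?_⟩
  intro k hk
  by_cases h1 : k + 1 ≤ n
  · have h2 : k ≤ n := by omega
    simp only [h1, h2, if_true]
    exact hp k h1
  · have h2 : k = n := by omega
    subst h2
    simpa [hn] using hs

theorem Reach.mem {Ω : Set ℂ} {lam : ℂ → ℝ} {n : ℕ} {l : ℝ} {x y : ℂ} (h : Reach Ω lam n l x y)
    (hx : x ∈ Ω) : y ∈ Ω := by
  obtain ⟨p, h0, hn, hp⟩ := h
  rcases n with _ | n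
  · rw [← hn, h0]; exact hx
  · rw [← hn]; exact (hp n (by omega)).mem_right

theorem Reach.mono {Ω : Set ℂ} {lam : ℂ → ℝ} {n m : ℕ} {l : ℝ} {x y : ℂ} (h : Reach Ω lam n l x y)
    (hx : x ∈ Ω) (hl : 0 ≤ l) (hnm : n ≤ m) : Reach Ω lam m l x y := by
  induction m, hnm using Nat.le_induction with
  | base => exact h
  | succ m _ ih => exact ih.succ (step_refl (h.mem hx) hl)

theorem point_pick {Ω : Set ℂ} (hΩ : IsOpen Ω) {lam : ℂ → ℝ} (hcomp : MetricComplete Ω lam)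
    (hlamc : ContinuousOn lam Ω) (hlamp : ∀ z ∈ Ω, 0 < lam z) {κ : ℂ → ℝ} (hκ : ContinuousOn κ Ω)
    {z0 : ℂ} (hz0 : z0 ∈ Ω) (hκ0 : 0 < κ z0) (N : ℕ) :
    ∃ q ∈ Ω, 0 < κ q ∧ ∀ y, Reach Ω lam N (1 / κ q) q y → κ y ≤ 2 * κ q := by
  by_contra hcon
  push Not at hcon
  obtain ⟨n, hNn⟩ : ∃ n : ℕ, n = N + 1 := ⟨_, rfl⟩
  have hn : 0 < n := by omega
  have hstep : ∀ q : {q : ℂ // q ∈ Ω ∧ 0 < κ q}, ∃ q' : {q : ℂ // q ∈ Ω ∧ 0 < κ q},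
      Reach Ω lam n (1 / κ q) q q' ∧ 2 * κ q < κ q' := by
    rintro ⟨q, hq, hq0⟩
    obtain ⟨y, hy, h2⟩ := hcon q hq hq0
    exact ⟨⟨y, hy.mem hq, by linarith⟩, hy.mono hq (by positivity) (by omega), h2⟩
  choose f hf hf2 using hstep
  set q : ℕ → {q : ℂ // q ∈ Ω ∧ 0 < κ q} := fun i => f^[i] ⟨z0, hz0, hκ0⟩ with hq
  have hqs : ∀ i, q (i + 1) = f (q i) := fun i => Function.iterate_succ_apply' f i _
  have hgrow : ∀ i, 2 ^ i * κ z0 ≤ κ (q i) := by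
    intro i
    induction i with
    | zero => simp [hq]
    | succ i ih =>
      have := hf2 (q i)
      rw [← hqs] at this
      rw [pow_succ]; linarith
  have hR : ∀ i, Reach Ω lam n (1 / κ (q i)) (q i) (q (i + 1)) := by
    intro i; rw [hqs]; exact hf (q i)
  choose P hP0 hPn hPs using hR
  set y : ℕ → ℂ := fun m => P (m / n) (m % n) with hy
  set l : ℕ → ℝ := fun m => 1 / κ (q (m / n)) with hl
  have hst : ∀ m, Step Ω lam (l m) (y m) (y (m + 1)) := by
    intro m
    have hlt := Nat.mod_lt m hn
    have e : y (m + 1) = P (m / n) (m % n + 1) := by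
      simp only [hy]
      by_cases h : m % n + 1 < n
      · have h1 : (m + 1) % n = m % n + 1 := by
          rw [Nat.add_mod, Nat.mod_eq_of_lt (a := m % n + 1 % n)]
          · by_cases h1 : n = 1
            · omega
            · rw [Nat.mod_eq_of_lt (by omega : 1 < n)]
          · by_cases h1 : n = 1
            · omega
            · rw [Nat.mod_eq_of_lt (by omega : 1 < n)]; exact h
        have h2 : (m + 1) / n = m / n := by
          rw [Nat.succ_div, if_neg]
          · simp
          · intro hd
            have := Nat.mod_eq_zero_of_dvd hd
            omega
        rw [h1, h2]
      · have h0 : m % n + 1 = n := by omega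
        have hd : n ∣ m + 1 := by
          have := Nat.div_add_mod m n
          refine ⟨m / n + 1, ?_⟩
          rw [mul_add, mul_one]; omega
        have h1 : (m + 1) % n = 0 := Nat.mod_eq_zero_of_dvd hd
        have h2 : (m + 1) / n = m / n + 1 := by rw [Nat.succ_div, if_pos hd]
        rw [h1, h2, h0, hP0, hPn]
    rw [e]
    exact hPs (m / n) (m % n) hlt
  have hsum : Summable l := by
    have hg : Summable (fun i : ℕ => 1 / κ (q i)) := by
      apply Summable.of_nonneg_of_le (fun i => by have := (q i).2.2; positivity)
        (f := fun i => (1 / κ z0) * (1 / 2) ^ i)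
      · intro i
        have := hgrow i
        have h2 : 1 / κ (q i) ≤ 1 / (2 ^ i * κ z0) := by gcongr
        refine h2.trans (le_of_eq ?_)
        rw [div_pow]; field_simp; simp
      · exact summable_geometric_two.mul_left _
    haveI : NeZero n := ⟨hn.ne'⟩
    have h1 : Summable (fun p : ℕ × Fin n => 1 / κ (q p.1) * 1) :=
      Summable.mul_of_nonneg hg (g := fun _ : Fin n => (1:ℝ)) (Summable.of_finite)
        (fun i => by have := (q i).2.2; simp only [Pi.zero_apply]; positivity) (fun _ => zero_le_one)
    have h2 := (Nat.divModEquiv n).summable_iff.2 h1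
    refine h2.congr (fun m => ?_)
    simp [hl, Nat.divModEquiv]
  obtain ⟨z, hz, hlim⟩ := complete_lim hΩ hcomp hlamc hlamp hst hsum
  have hsub : Tendsto (fun i : ℕ => y (n * i)) atTop (𝓝 z) :=
    hlim.comp (tendsto_id.const_mul_atTop' hn)
  have hyq : ∀ i, y (n * i) = q i := by
    intro i
    simp only [hy]
    rw [Nat.mul_div_cancel_left _ hn, Nat.mul_mod_right, hP0]
  simp only [hyq] at hsub
  have hκl : Tendsto (fun i => κ (q i)) atTop (𝓝 (κ z)) :=
    ((hκ.continuousAt (hΩ.mem_nhds hz)).tendsto).comp hsub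
  have hinf : Tendsto (fun i => κ (q i)) atTop atTop := by
    apply tendsto_atTop_mono hgrow
    exact (tendsto_pow_atTop_atTop_of_one_lt (by norm_num)).atTop_mul_const hκ0
  exact not_tendsto_nhds_of_tendsto_atTop hinf _ hκl

end Isl


namespace Isl
open Set Metric Filter Topology

/-- `φ` solves `φ' = 1 / k(φ)` on `O`, with values in `Ω`. -/
def Sol (Ω : Set ℂ) (k : ℂ → ℂ) (O : Set ℂ) (φ : ℂ → ℂ) : Prop :=
  ∀ w ∈ O, φ w ∈ Ω ∧ k (φ w) ≠ 0 ∧ HasDerivAt φ (k (φ w))⁻¹ w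

theorem Sol.mono {Ω : Set ℂ} {k : ℂ → ℂ} {O O' : Set ℂ} {φ : ℂ → ℂ} (h : Sol Ω k O φ) (hO : O' ⊆ O) :
    Sol Ω k O' φ := fun w hw => h w (hO hw)

theorem Sol.glue {Ω : Set ℂ} {k : ℂ → ℂ} {O : Set ℂ} {Φ : ℂ → ℂ}
    (h : ∀ z ∈ O, ∃ O1 ψ, z ∈ O1 ∧ Sol Ω k O1 ψ ∧ Φ =ᶠ[𝓝 z] ψ) : Sol Ω k O Φ := by
  intro z hz
  obtain ⟨O1, ψ, hz1, hs, he⟩ := h z hz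
  obtain ⟨h1, h2, h3⟩ := hs z hz1
  have e : Φ z = ψ z := he.eq_of_nhds
  rw [e]
  exact ⟨h1, h2, h3.congr_of_eventuallyEq he⟩

theorem prim_local {Ω : Set ℂ} (hΩ : IsOpen Ω) {k : ℂ → ℂ} (hk : DifferentiableOn ℂ k Ω) {y0 : ℂ}
    (hy : y0 ∈ Ω) (hk0 : k y0 ≠ 0) :
    ∃ r > 0, ∃ P : ℂ → ℂ, ball y0 r ⊆ Ω ∧ (∀ z ∈ ball y0 r, k z ≠ 0 ∧ HasDerivAt P (k z) z) ∧
      HasStrictDerivAt P (k y0) y0 := by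
  have h1 : ∀ᶠ z in 𝓝 y0, z ∈ Ω ∧ k z ≠ 0 :=
    (hΩ.eventually_mem hy).and
      ((hk.continuousOn.continuousAt (hΩ.mem_nhds hy)).eventually_ne hk0)
  obtain ⟨r, hr, hb⟩ := Metric.eventually_nhds_iff_ball.1 h1
  have hs : ball y0 r ⊆ Ω := fun z hz => (hb z hz).1
  obtain ⟨P, hP⟩ := (hk.mono hs).isExactOn_ball
  refine ⟨r, hr, P, hs, fun z hz => ⟨(hb z hz).2, hP z hz⟩, ?_⟩
  have hd : DifferentiableOn ℂ P (ball y0 r) := fun z hz => (hP z hz).differentiableAt.differentiableWithinAt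
  have ha : AnalyticAt ℂ P y0 := hd.analyticAt (ball_mem_nhds _ hr)
  have := ha.hasStrictDerivAt
  rwa [(hP y0 (mem_ball_self hr)).deriv] at this

theorem sol_local {Ω : Set ℂ} (hΩ : IsOpen Ω) {k : ℂ → ℂ} (hk : DifferentiableOn ℂ k Ω) {y0 : ℂ}
    (hy : y0 ∈ Ω) (hk0 : k y0 ≠ 0) :
    ∃ δ > 0, ∀ᶠ y in 𝓝 y0, ∀ c, ∃ ψ, Sol Ω k (ball c δ) ψ ∧ ψ c = y := by
  obtain ⟨r, hr, P, hs, hP, hst⟩ := prim_local hΩ hk hy hk0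
  let e := ((hst.hasStrictFDerivAt_equiv hk0).toOpenPartialHomeomorph P).restrOpen (ball y0 r) isOpen_ball
  have hcoe : ∀ z, e z = P z := fun z => rfl
  have hsrc : y0 ∈ e.source :=
    ⟨(hst.hasStrictFDerivAt_equiv hk0).mem_toOpenPartialHomeomorph_source, mem_ball_self hr⟩
  have hsub : e.source ⊆ ball y0 r := fun z hz => hz.2
  have htgt : P y0 ∈ e.target := e.map_source hsrc
  obtain ⟨d, hd, hball⟩ := Metric.isOpen_iff.1 e.open_target _ htgt
  refine ⟨d / 2, by positivity, ?_⟩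
  have hPc : ContinuousAt P y0 := (hP y0 (mem_ball_self hr)).2.continuousAt
  filter_upwards [e.open_source.eventually_mem hsrc, hPc.eventually (ball_mem_nhds _ (half_pos hd))]
    with y hy1 hy2 c
  refine ⟨fun w => e.symm (P y + (w - c)), ?_, ?_⟩
  · intro w hw
    have hmem : P y + (w - c) ∈ e.target := by
      apply hball
      rw [mem_ball, dist_eq_norm] at hw ⊢
      have hy2 : dist (P y) (P y0) < d / 2 := hy2
      rw [dist_eq_norm] at hy2
      calc ‖P y + (w - c) - P y0‖ = ‖(P y - P y0) + (w - c)‖ := by ring_nf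
        _ ≤ ‖P y - P y0‖ + ‖w - c‖ := norm_add_le _ _
        _ < d := by linarith
    have h1 := hsub (e.map_target hmem)
    obtain ⟨h2, h3⟩ := hP _ h1
    refine ⟨hs h1, h2, ?_⟩
    have h4 := e.hasDerivAt_symm hmem h2 h3
    have h5 : HasDerivAt (fun w => P y + (w - c)) 1 w := by
      simpa using ((hasDerivAt_id w).sub_const c).const_add (P y)
    have := h4.comp w h5
    rw [mul_one] at this
    exact this
  · simp only [sub_self, add_zero]
    exact e.left_inv hy1

theorem sol_unique {Ω : Set ℂ} (hΩ : IsOpen Ω) {k : ℂ → ℂ} (hk : DifferentiableOn ℂ k Ω)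
    {O : Set ℂ} (hO : IsOpen O) (hc : IsPreconnected O) {φ ψ : ℂ → ℂ} (h1 : Sol Ω k O φ)
    (h2 : Sol Ω k O ψ) {w0 : ℂ} (hw : w0 ∈ O) (he : φ w0 = ψ w0) : EqOn φ ψ O := by
  obtain ⟨hy, hk0, hd1⟩ := h1 w0 hw
  obtain ⟨-, -, hd2⟩ := h2 w0 hw
  obtain ⟨r, hr, P, hs, hP, hst⟩ := prim_local hΩ hk hy hk0
  have a1 : AnalyticOnNhd ℂ φ O := DifferentiableOn.analyticOnNhd
    (fun w hw => (h1 w hw).2.2.differentiableAt.differentiableWithinAt) hO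
  have a2 : AnalyticOnNhd ℂ ψ O := DifferentiableOn.analyticOnNhd
    (fun w hw => (h2 w hw).2.2.differentiableAt.differentiableWithinAt) hO
  refine a1.eqOn_of_preconnected_of_eventuallyEq a2 hc hw ?_
  have hL := (hst.hasStrictFDerivAt_equiv hk0).eventually_left_inverse
  have ev : ∀ᶠ w in 𝓝 w0, w ∈ O ∧ φ w ∈ ball (φ w0) r ∧ ψ w ∈ ball (φ w0) r :=
    (hO.eventually_mem hw).and ((hd1.continuousAt.eventually (ball_mem_nhds _ hr)).and
      (by rw [he]; exact hd2.continuousAt.eventually (ball_mem_nhds _ hr)))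
  obtain ⟨s, hs0, hsb⟩ := Metric.eventually_nhds_iff_ball.1 ev
  have hEq : EqOn (fun w => P (φ w)) (fun w => P (ψ w)) (ball w0 s) := by
    have D1 : ∀ w ∈ ball w0 s, HasDerivAt (fun w => P (φ w)) 1 w := by
      intro w hw
      obtain ⟨i1, i2, i3⟩ := hsb w hw
      have := (hP _ i2).2.comp w (h1 w i1).2.2
      rwa [mul_inv_cancel₀ (h1 w i1).2.1] at this
    have D2 : ∀ w ∈ ball w0 s, HasDerivAt (fun w => P (ψ w)) 1 w := by
      intro w hw
      obtain ⟨i1, i2, i3⟩ := hsb w hw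
      have := (hP _ i3).2.comp w (h2 w i1).2.2
      rwa [mul_inv_cancel₀ (h2 w i1).2.1] at this
    refine isOpen_ball.eqOn_of_deriv_eq (convex_ball _ _).isPreconnected
      (fun w hw => (D1 w hw).differentiableAt.differentiableWithinAt)
      (fun w hw => (D2 w hw).differentiableAt.differentiableWithinAt) ?_ (mem_ball_self hs0) ?_
    · intro w hw
      rw [(D1 w hw).deriv, (D2 w hw).deriv]
    · simp only [he]
  have L1 := hd1.continuousAt.eventually hL
  have L2 : ∀ᶠ w in 𝓝 w0, _ := hd2.continuousAt.eventually (by rw [← he]; exact hL)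
  filter_upwards [L1, L2, ball_mem_nhds w0 hs0] with w e1 e2 hw
  rw [← e1, ← e2]
  congr 1
  exact hEq hw

theorem sol_extend {Ω : Set ℂ} (hΩ : IsOpen Ω) {k : ℂ → ℂ} (hk : DifferentiableOn ℂ k Ω)
    {R δ : ℝ} (hR : 0 < R) (hδ : 0 < δ) {φ : ℂ → ℂ} (h1 : Sol Ω k (ball 0 R) φ)
    (h2 : ∀ w ∈ ball (0:ℂ) R, ∃ ψ, Sol Ω k (ball w δ) ψ ∧ ψ w = φ w) :
    ∃ Φ, Sol Ω k (ball 0 (R + δ / 2)) Φ ∧ Φ 0 = φ 0 := by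
  choose! ψ hψ hψe using h2
  obtain ⟨s, hsdef⟩ : ∃ s : ℝ, s = R / (R + δ / 2) := ⟨_, rfl⟩
  have hp : 0 < R + δ / 2 := by positivity
  have hs0 : 0 < s := by rw [hsdef]; positivity
  have hs1 : s < 1 := by rw [hsdef, div_lt_one hp]; linarith
  have hsm : s * (R + δ / 2) = R := by rw [hsdef]; field_simp
  have nrm : ∀ z : ℂ, ‖(s:ℂ) * z‖ = s * ‖z‖ := by
    intro z; rw [norm_mul, Complex.norm_real, Real.norm_of_nonneg hs0.le]
  have hin : ∀ z ∈ ball (0:ℂ) (R + δ / 2), (s:ℂ) * z ∈ ball (0:ℂ) R := by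
    intro z hz
    rw [mem_ball_zero_iff] at hz ⊢
    rw [nrm, ← hsm]
    exact mul_lt_mul_of_pos_left hz hs0
  have hclose : ∀ z ∈ ball (0:ℂ) (R + δ / 2), ‖z - (s:ℂ) * z‖ < δ / 2 := by
    intro z hz
    rw [mem_ball_zero_iff] at hz
    have : z - (s:ℂ) * z = ((1 - s : ℝ) : ℂ) * z := by push_cast; ring
    rw [this, norm_mul, Complex.norm_real, Real.norm_of_nonneg (by linarith)]
    calc (1 - s) * ‖z‖ < (1 - s) * (R + δ / 2) := mul_lt_mul_of_pos_left hz (by linarith)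
      _ = δ / 2 := by rw [sub_mul, hsm]; ring
  have agree : ∀ z ∈ ball (0:ℂ) (R + δ / 2), ∀ z1 ∈ ball (0:ℂ) (R + δ / 2), ‖z - z1‖ < δ / 2 →
      ψ (s * z) z = ψ (s * z1) z := by
    intro z hz z1 hz1 hd
    have hsd : ‖(s:ℂ) * z - s * z1‖ < δ := by
      rw [← mul_sub, nrm]
      calc s * ‖z - z1‖ ≤ 1 * ‖z - z1‖ := mul_le_mul_of_nonneg_right hs1.le (norm_nonneg _)
        _ < δ := by linarith
    have m1 : (s:ℂ) * z1 ∈ ball (s * z : ℂ) δ := by rw [mem_ball, dist_comm, dist_eq_norm]; exact hsd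
    have A : EqOn (ψ (s * z)) φ (ball 0 R ∩ ball (s * z : ℂ) δ) :=
      sol_unique hΩ hk (isOpen_ball.inter isOpen_ball)
        ((convex_ball _ _).inter (convex_ball _ _)).isPreconnected
        ((hψ _ (hin z hz)).mono inter_subset_right) (h1.mono inter_subset_left)
        ⟨hin z hz, mem_ball_self hδ⟩ (hψe _ (hin z hz))
    have B : EqOn (ψ (s * z)) (ψ (s * z1)) (ball (s * z1 : ℂ) δ ∩ ball (s * z : ℂ) δ) :=
      sol_unique hΩ hk (isOpen_ball.inter isOpen_ball)
        ((convex_ball _ _).inter (convex_ball _ _)).isPreconnected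
        ((hψ _ (hin z hz)).mono inter_subset_right) ((hψ _ (hin z1 hz1)).mono inter_subset_left)
        ⟨mem_ball_self hδ, m1⟩ (by rw [hψe _ (hin z1 hz1)]; exact A ⟨hin z1 hz1, m1⟩)
    refine B ⟨?_, ?_⟩
    · rw [mem_ball, dist_eq_norm]
      calc ‖z - s * z1‖ = ‖(z - z1) + (z1 - s * z1)‖ := by ring_nf
        _ ≤ ‖z - z1‖ + ‖z1 - s * z1‖ := norm_add_le _ _
        _ < δ := by have := hclose z1 hz1; linarith
    · rw [mem_ball, dist_eq_norm]
      have := hclose z hz; linarith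
  refine ⟨fun z => ψ (s * z) z, Sol.glue fun z1 hz1 => ⟨ball (s * z1 : ℂ) δ, ψ (s * z1), ?_, hψ _ (hin z1 hz1), ?_⟩, ?_⟩
  · rw [mem_ball, dist_eq_norm]
    have := hclose z1 hz1; linarith
  · filter_upwards [isOpen_ball.mem_nhds hz1, ball_mem_nhds z1 (half_pos hδ)] with z hz hz2
    rw [mem_ball, dist_eq_norm] at hz2
    exact agree z hz z1 hz1 hz2
  · simp only [mul_zero]
    exact hψe 0 (mem_ball_self hR)

theorem sol_global {Ω : Set ℂ} (hΩ : IsOpen Ω) {k : ℂ → ℂ} (hk : DifferentiableOn ℂ k Ω)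
    {c : ℝ} (hc : 0 < c) {x : ℂ} (hx : x ∈ Ω) (hkx : k x ≠ 0)
    (H : ∀ R, 0 < R → R ≤ c → ∀ φ, Sol Ω k (ball 0 R) φ → φ 0 = x →
      ∃ δ > 0, ∀ w ∈ ball (0:ℂ) R, ∃ ψ, Sol Ω k (ball w δ) ψ ∧ ψ w = φ w) :
    ∃ φ, Sol Ω k (ball 0 c) φ ∧ φ 0 = x := by
  let A : Set ℝ := {r | 0 < r ∧ r ≤ c ∧ ∃ φ, Sol Ω k (ball 0 r) φ ∧ φ 0 = x}
  have hAdef : ∀ r, r ∈ A ↔ 0 < r ∧ r ≤ c ∧ ∃ φ, Sol Ω k (ball 0 r) φ ∧ φ 0 = x := fun r => Iff.rfl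
  have hAne : A.Nonempty := by
    obtain ⟨δ, hδ, hev⟩ := sol_local hΩ hk hx hkx
    obtain ⟨ψ, h1, h2⟩ := hev.self_of_nhds 0
    exact ⟨min δ c, lt_min hδ hc, min_le_right _ _, ψ, h1.mono (ball_subset_ball (min_le_left _ _)), h2⟩
  have hbdd : BddAbove A := ⟨c, fun r hr => hr.2.1⟩
  obtain ⟨R, hRdef⟩ : ∃ R, R = sSup A := ⟨_, rfl⟩
  have hR0 : 0 < R := by
    obtain ⟨r, hr⟩ := hAne
    exact hr.1.trans_le (hRdef ▸ le_csSup hbdd hr)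
  have hRc : R ≤ c := hRdef ▸ csSup_le hAne fun r hr => hr.2.1
  have hex : ∀ w ∈ ball (0:ℂ) R, ∃ r φ, w ∈ ball (0:ℂ) r ∧ 0 < r ∧ Sol Ω k (ball 0 r) φ ∧ φ 0 = x := by
    intro w hw
    rw [mem_ball_zero_iff, hRdef] at hw
    obtain ⟨r, hr, hlt⟩ := exists_lt_of_lt_csSup hAne hw
    obtain ⟨h0, -, φ, h1, h2⟩ := hr
    exact ⟨r, φ, by rwa [mem_ball_zero_iff], h0, h1, h2⟩
  choose! rr ψ hm h0 hS hx0 using hex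
  have hglue : Sol Ω k (ball 0 R) (fun w => ψ w w) := by
    refine Sol.glue fun w1 hw1 => ⟨_, ψ w1, hm w1 hw1, hS w1 hw1, ?_⟩
    filter_upwards [isOpen_ball.mem_nhds hw1, isOpen_ball.mem_nhds (hm w1 hw1)] with w hw hw2
    refine sol_unique hΩ hk (isOpen_ball.inter isOpen_ball)
      ((convex_ball (0:ℂ) (rr w)).inter (convex_ball (0:ℂ) (rr w1))).isPreconnected
      ((hS w hw).mono inter_subset_left) ((hS w1 hw1).mono inter_subset_right)
      (w0 := 0) ⟨mem_ball_self (h0 w hw), mem_ball_self (h0 w1 hw1)⟩ ?_ ⟨hm w hw, hw2⟩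
    rw [hx0 w hw, hx0 w1 hw1]
  have hg0 : (fun w => ψ w w) 0 = x := hx0 0 (mem_ball_self hR0)
  rcases hRc.eq_or_lt with h | h
  · rw [← h]; exact ⟨_, hglue, hg0⟩
  · obtain ⟨δ, hδ, hloc⟩ := H R hR0 hRc _ hglue hg0
    obtain ⟨Φ, hΦ, hΦ0⟩ := sol_extend hΩ hk hR0 hδ hglue hloc
    have : min (R + δ / 2) c ∈ A :=
      ⟨lt_min (by positivity) hc, min_le_right _ _, Φ, hΦ.mono (ball_subset_ball (min_le_left _ _)),
        hΦ0.trans hg0⟩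
    have h3 := le_csSup hbdd this
    rw [← hRdef] at h3
    have : R < min (R + δ / 2) c := lt_min (by linarith) h
    linarith

end Isl


namespace Isl
open Set Metric Filter Topology

/-- Density of the metric. -/
noncomputable def lm (h g : ℂ → ℂ) (z : ℂ) : ℝ := Real.sqrt (‖h z‖ ^ 2 + ‖g z‖ ^ 2)

/-- The Wronskian. -/
noncomputable def Wr (h g : ℂ → ℂ) (z : ℂ) : ℂ := h z * deriv g z - g z * deriv h z

/-- Curvature-type quantity. -/
noncomputable def kap (h g : ℂ → ℂ) (z : ℂ) : ℝ := ‖Wr h g z‖ / (lm h g z) ^ 3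

/-- The standing assumptions on the data. -/
structure Data (Ω : Set ℂ) (h g : ℂ → ℂ) : Prop where
  op : IsOpen Ω
  dh : DifferentiableOn ℂ h Ω
  dg : DifferentiableOn ℂ g Ω
  nz : ∀ z ∈ Ω, h z ≠ 0 ∨ g z ≠ 0
  comp : MetricComplete Ω (lm h g)

theorem Data.lm_pos {Ω : Set ℂ} {h g : ℂ → ℂ} (D : Data Ω h g) {z : ℂ} (hz : z ∈ Ω) : 0 < lm h g z := by
  apply Real.sqrt_pos.2
  rcases D.nz z hz with h1 | h1
  · have := norm_pos_iff.2 h1; positivity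
  · have := norm_pos_iff.2 h1; positivity

theorem Data.lm_cont {Ω : Set ℂ} {h g : ℂ → ℂ} (D : Data Ω h g) : ContinuousOn (lm h g) Ω :=
  ((D.dh.continuousOn.norm.pow 2).add (D.dg.continuousOn.norm.pow 2)).sqrt

theorem Data.Wr_diff {Ω : Set ℂ} {h g : ℂ → ℂ} (D : Data Ω h g) : DifferentiableOn ℂ (Wr h g) Ω :=
  (D.dh.mul (D.dg.deriv D.op)).sub (D.dg.mul (D.dh.deriv D.op))

theorem Data.kap_cont {Ω : Set ℂ} {h g : ℂ → ℂ} (D : Data Ω h g) : ContinuousOn (kap h g) Ω :=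
  D.Wr_diff.continuousOn.norm.div (D.lm_cont.pow 3) (fun _ hz => (pow_pos (D.lm_pos hz) 3).ne')

/-- A unitarily normalised chart of size `1/8` at scale `L`. -/
structure Chart (Ω : Set ℂ) (h g : ℂ → ℂ) (L : ℝ) (x a b : ℂ) (φ ρ : ℂ → ℂ) : Prop where
  unit : ‖a‖ ^ 2 + ‖b‖ ^ 2 = 1
  dφ : DifferentiableOn ℂ φ (ball 0 (1 / 8))
  maps : ∀ w ∈ ball (0:ℂ) (1 / 8), φ w ∈ Ω
  φ0 : φ 0 = x
  dρ : DifferentiableOn ℂ ρ (ball 0 (1 / 8))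
  eqh : ∀ w ∈ ball (0:ℂ) (1 / 8), L * h (φ w) * deriv φ w = a - (starRingEnd ℂ) b * ρ w
  eqg : ∀ w ∈ ball (0:ℂ) (1 / 8), L * g (φ w) * deriv φ w = b + (starRingEnd ℂ) a * ρ w
  der : ∀ w ∈ ball (0:ℂ) (1 / 8), deriv ρ w = L ^ 2 * (deriv φ w) ^ 3 * Wr h g (φ w)
  ne : ∀ w ∈ ball (0:ℂ) (1 / 8), deriv φ w ≠ 0
  ρ0 : ρ 0 = 0
  bd : ∀ w ∈ ball (0:ℂ) (1 / 8), ‖ρ w‖ ≤ 1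
  step : ∀ w ∈ ball (0:ℂ) (1 / 8), Step Ω (lm h g) (1 / L) x (φ w)

/-- The denominator. -/
noncomputable def kk (L : ℝ) (a b : ℂ) (h g : ℂ → ℂ) (z : ℂ) : ℂ :=
  L * ((starRingEnd ℂ) a * h z + (starRingEnd ℂ) b * g z)

/-- The normalised ratio. -/
noncomputable def rh (L : ℝ) (a b : ℂ) (h g : ℂ → ℂ) (z : ℂ) : ℂ :=
  L * (a * g z - b * h z) * (kk L a b h g z)⁻¹

theorem unit_mul {a b : ℂ} (u : ‖a‖ ^ 2 + ‖b‖ ^ 2 = 1) :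
    a * (starRingEnd ℂ) a + b * (starRingEnd ℂ) b = 1 := by
  rw [Complex.mul_conj, Complex.mul_conj, Complex.normSq_eq_norm_sq, Complex.normSq_eq_norm_sq]
  exact_mod_cast u

theorem rh_eqh {L : ℝ} {a b : ℂ} {h g : ℂ → ℂ} (u : ‖a‖ ^ 2 + ‖b‖ ^ 2 = 1) {z : ℂ}
    (hk : kk L a b h g z ≠ 0) :
    L * h z * (kk L a b h g z)⁻¹ = a - (starRingEnd ℂ) b * rh L a b h g z := by
  have u' := unit_mul u
  have e : L * h z = a * kk L a b h g z - (starRingEnd ℂ) b * (L * (a * g z - b * h z)) := by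
    unfold kk; linear_combination (-(L:ℂ) * h z) * u'
  rw [e, rh]
  field_simp

theorem rh_eqg {L : ℝ} {a b : ℂ} {h g : ℂ → ℂ} (u : ‖a‖ ^ 2 + ‖b‖ ^ 2 = 1) {z : ℂ}
    (hk : kk L a b h g z ≠ 0) :
    L * g z * (kk L a b h g z)⁻¹ = b + (starRingEnd ℂ) a * rh L a b h g z := by
  have u' := unit_mul u
  have e : L * g z = b * kk L a b h g z + (starRingEnd ℂ) a * (L * (a * g z - b * h z)) := by
    unfold kk; linear_combination (-(L:ℂ) * g z) * u'
  rw [e, rh]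
  field_simp

theorem rh_der {Ω : Set ℂ} {h g : ℂ → ℂ} (D : Data Ω h g) {L : ℝ} {a b : ℂ}
    (u : ‖a‖ ^ 2 + ‖b‖ ^ 2 = 1) {z : ℂ} (hz : z ∈ Ω) (hk : kk L a b h g z ≠ 0) :
    HasDerivAt (rh L a b h g) (L ^ 2 * ((kk L a b h g z)⁻¹) ^ 2 * Wr h g z) z := by
  have u' := unit_mul u
  have h1 := (D.dh.differentiableAt (D.op.mem_nhds hz)).hasDerivAt
  have h2 := (D.dg.differentiableAt (D.op.mem_nhds hz)).hasDerivAt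
  have hK : HasDerivAt (kk L a b h g)
      (L * ((starRingEnd ℂ) a * deriv h z + (starRingEnd ℂ) b * deriv g z)) z :=
    ((h1.const_mul _).add (h2.const_mul _)).const_mul _
  have hN : HasDerivAt (fun z => L * (a * g z - b * h z)) (L * (a * deriv g z - b * deriv h z)) z :=
    ((h2.const_mul _).sub (h1.const_mul _)).const_mul _
  have hq := hN.mul (hK.inv hk)
  refine HasDerivAt.congr_deriv hq ?_
  have e : (L * (a * deriv g z - b * deriv h z)) * kk L a b h g z
      - (L * (a * g z - b * h z)) * (L * ((starRingEnd ℂ) a * deriv h z + (starRingEnd ℂ) b * deriv g z))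
      = L ^ 2 * Wr h g z := by
    unfold kk Wr; linear_combination ((L:ℂ) ^ 2 * (h z * deriv g z - g z * deriv h z)) * u'
  rw [Pi.inv_apply]
  field_simp
  linear_combination e

theorem lm_eq {h g : ℂ → ℂ} {L : ℝ} (hL : 0 < L) {a b d r : ℂ} {z : ℂ} (u : ‖a‖ ^ 2 + ‖b‖ ^ 2 = 1)
    (e1 : L * h z * d = a - (starRingEnd ℂ) b * r) (e2 : L * g z * d = b + (starRingEnd ℂ) a * r) :
    L * lm h g z * ‖d‖ = Real.sqrt (1 + ‖r‖ ^ 2) := by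
  have := frame_norm a b r u
  rw [← e1, ← e2] at this
  rw [← this, lm]
  simp only [norm_mul, Complex.norm_real, Real.norm_of_nonneg hL.le]
  rw [show (L * ‖h z‖ * ‖d‖) ^ 2 + (L * ‖g z‖ * ‖d‖) ^ 2 = (‖h z‖ ^ 2 + ‖g z‖ ^ 2) * (L * ‖d‖) ^ 2 by ring,
    Real.sqrt_mul (by positivity), Real.sqrt_sq (by positivity)]
  ring

theorem sqrt_le_32 {r : ℂ} (hr : ‖r‖ ≤ 1) : Real.sqrt (1 + ‖r‖ ^ 2) ≤ 3 / 2 := by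
  rw [Real.sqrt_le_left (by norm_num)]
  nlinarith [norm_nonneg r]

theorem kap_eq {h g : ℂ → ℂ} {L : ℝ} (hL : 0 < L) {a b d r ρ' : ℂ} {z : ℂ} (u : ‖a‖ ^ 2 + ‖b‖ ^ 2 = 1)
    (hp : 0 < lm h g z) (hd : d ≠ 0)
    (e1 : L * h z * d = a - (starRingEnd ℂ) b * r) (e2 : L * g z * d = b + (starRingEnd ℂ) a * r)
    (e3 : ρ' = L ^ 2 * d ^ 3 * Wr h g z) :
    L * ‖ρ'‖ = kap h g z * Real.sqrt (1 + ‖r‖ ^ 2) ^ 3 := by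
  rw [← lm_eq hL u e1 e2, e3, kap]
  simp only [norm_mul, norm_pow, Complex.norm_real, Real.norm_of_nonneg hL.le]
  field_simp

/-- a priori facts for a solution -/
theorem sol_step {Ω : Set ℂ} {h g : ℂ → ℂ} (D : Data Ω h g) {L : ℝ} (hL : 0 < L) {a b : ℂ}
    (u : ‖a‖ ^ 2 + ‖b‖ ^ 2 = 1) {O : Set ℂ} {φ : ℂ → ℂ} (hS : Sol Ω (kk L a b h g) O φ)
    {w w' : ℂ} {l : ℝ} (hseg : ∀ t ∈ Icc (0:ℝ) 1, w + t * (w' - w) ∈ O ∧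
      ‖rh L a b h g (φ (w + t * (w' - w)))‖ ≤ 1) (hl : 3 / 2 * ‖w' - w‖ / L ≤ l) :
    Step Ω (lm h g) l (φ w) (φ w') := by
  have hk : DifferentiableOn ℂ (kk L a b h g) Ω :=
    ((D.dh.const_mul _).add (D.dg.const_mul _)).const_mul _
  refine ⟨fun t => φ (w + t * (w' - w)),
    fun t => (kk L a b h g (φ (w + t * (w' - w))))⁻¹ * (w' - w), ?_, ?_, by simp, by simp⟩
  · intro t ht
    obtain ⟨m, hr⟩ := hseg t ht
    obtain ⟨i1, i2, i3⟩ := hS _ m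
    refine ⟨?_, i1, ?_⟩
    · have hlin : HasDerivAt (fun t : ℝ => w + (t:ℂ) * (w' - w)) (w' - w) t := by
        simpa using ((Complex.ofRealCLM.hasDerivAt (x := t)).mul_const (w' - w)).const_add w
      exact i3.comp t hlin
    · have e := lm_eq hL u (rh_eqh u i2) (rh_eqg u i2)
      have e2 := sqrt_le_32 hr
      rw [← e] at e2
      refine le_trans ?_ hl
      rw [norm_mul, le_div_iff₀ hL]
      have := mul_le_mul_of_nonneg_right e2 (norm_nonneg (w' - w))
      linarith
  · have hc : ContinuousOn (fun t : ℝ => φ (w + t * (w' - w))) (Icc 0 1) := by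
      intro t ht
      have := (hS _ (hseg t ht).1).2.2.continuousAt
      have h2 : ContinuousAt (fun t : ℝ => w + (t:ℂ) * (w' - w)) t := by fun_prop
      exact (ContinuousAt.comp (f := fun t : ℝ => w + (t:ℂ) * (w' - w)) (x := t) this h2).continuousWithinAt
    refine ContinuousOn.mul (ContinuousOn.inv₀ ?_ ?_) continuousOn_const
    · exact hk.continuousOn.comp hc (fun t ht => (hS _ (hseg t ht).1).1)
    · exact fun t ht => (hS _ (hseg t ht).1).2.1

theorem seg_ball {r : ℝ} {w w' : ℂ} (hw : w ∈ ball (0:ℂ) r) (hw' : w' ∈ ball (0:ℂ) r) {t : ℝ}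
    (ht : t ∈ Icc (0:ℝ) 1) : w + t * (w' - w) ∈ ball (0:ℂ) r := by
  have := (convex_ball (0:ℂ) r).add_smul_sub_mem hw hw' ht
  simpa using this

theorem sol_bd {Ω : Set ℂ} {h g : ℂ → ℂ} (D : Data Ω h g) {L : ℝ} (hL : 0 < L) {a b x : ℂ}
    (u : ‖a‖ ^ 2 + ‖b‖ ^ 2 = 1) (h0 : rh L a b h g x = 0)
    (hκ : ∀ y, Step Ω (lm h g) (1 / L) x y → kap h g y ≤ 2 * L)
    {r : ℝ} (hr : r ≤ 1 / 8) {φ : ℂ → ℂ} (hS : Sol Ω (kk L a b h g) (ball 0 r) φ) (hφ : φ 0 = x)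
    {w : ℂ} (hw : w ∈ ball (0:ℂ) r) : ‖rh L a b h g (φ w)‖ < 1 := by
  by_contra hcon
  push Not at hcon
  have hw8 : ‖w‖ < 1 / 8 := (mem_ball_zero_iff.1 hw).trans_le hr
  have hr0 : 0 < r := (norm_nonneg w).trans_lt (mem_ball_zero_iff.1 hw)
  have h0r : (0:ℂ) ∈ ball (0:ℂ) r := mem_ball_self hr0
  set f : ℝ → ℂ := fun t => rh L a b h g (φ (t * w)) with hf
  have hm : ∀ t ∈ Icc (0:ℝ) 1, (t:ℂ) * w ∈ ball (0:ℂ) r := by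
    intro t ht
    simpa using seg_ball h0r hw ht
  have hd : ∀ t ∈ Icc (0:ℝ) 1, HasDerivAt f
      (L ^ 2 * ((kk L a b h g (φ (t * w)))⁻¹) ^ 2 * Wr h g (φ (t * w)) *
        ((kk L a b h g (φ (t * w)))⁻¹ * w)) t := by
    intro t ht
    obtain ⟨i1, i2, i3⟩ := hS _ (hm t ht)
    have hlin : HasDerivAt (fun t : ℝ => (t:ℂ) * w) w t := by
      simpa using ((Complex.ofRealCLM.hasDerivAt (x := t)).mul_const w)
    exact (rh_der D u i1 i2).comp t (i3.comp t hlin)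
  have hfc : ContinuousOn f (Icc 0 1) := fun t ht => (hd t ht).continuousAt.continuousWithinAt
  have hcl : IsClosed (Icc (0:ℝ) 1 ∩ (fun t => ‖f t‖) ⁻¹' Ici 1) :=
    hfc.norm.preimage_isClosed_of_isClosed isClosed_Icc isClosed_Ici
  have hcomp : IsCompact (Icc (0:ℝ) 1 ∩ (fun t => ‖f t‖) ⁻¹' Ici 1) :=
    isCompact_Icc.of_isClosed_subset hcl inter_subset_left
  obtain ⟨T, ⟨hT, hT1⟩, hleast⟩ := hcomp.exists_isLeast ⟨1, ⟨zero_le_one, le_rfl⟩, by simpa [hf] using hcon⟩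
  have hT1 : 1 ≤ ‖f T‖ := hT1
  have hlt : ∀ t ∈ Ico (0:ℝ) T, ‖f t‖ < 1 := by
    intro t ht
    by_contra hc
    push Not at hc
    have := hleast ⟨⟨ht.1, ht.2.le.trans hT.2⟩, hc⟩
    exact absurd ht.2 (not_lt.2 this)
  have hb : ∀ t ∈ Ico (0:ℝ) T, ‖L ^ 2 * ((kk L a b h g (φ (t * w)))⁻¹) ^ 2 * Wr h g (φ (t * w)) *
        ((kk L a b h g (φ (t * w)))⁻¹ * w)‖ ≤ 27 / 4 * (1 / 8) := by
    intro t ht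
    have htI : t ∈ Icc (0:ℝ) 1 := ⟨ht.1, ht.2.le.trans hT.2⟩
    obtain ⟨i1, i2, i3⟩ := hS _ (hm t htI)
    have hst : Step Ω (lm h g) (1 / L) x (φ (t * w)) := by
      rw [← hφ]
      refine sol_step D hL u hS (w := 0) (w' := t * w) ?_ ?_
      · intro s hs
        have hst : s * t ∈ Ico (0:ℝ) T :=
          ⟨mul_nonneg hs.1 ht.1, (mul_le_of_le_one_left ht.1 hs.2).trans_lt ht.2⟩
        have e : (0:ℂ) + s * (t * w - 0) = ((s * t : ℝ) : ℂ) * w := by push_cast; ring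
        rw [e]
        exact ⟨hm _ ⟨hst.1, hst.2.le.trans hT.2⟩, (hlt _ hst).le⟩
      · rw [sub_zero]
        apply div_le_div_of_nonneg_right _ hL.le
        have : ‖(t:ℂ) * w‖ < 1 / 8 := (mem_ball_zero_iff.1 (hm t htI)).trans_le hr
        linarith
    have hk := hκ _ hst
    have e := kap_eq hL u (D.lm_pos i1) (inv_ne_zero i2) (rh_eqh u i2) (rh_eqg u i2) rfl
    have e2 := sqrt_le_32 (hlt t ht).le
    have e3 : Real.sqrt (1 + ‖f t‖ ^ 2) ^ 3 ≤ (3 / 2) ^ 3 := pow_le_pow_left₀ (Real.sqrt_nonneg _) e2 3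
    have e4 : L * ‖(L:ℂ) ^ 2 * ((kk L a b h g (φ (t * w)))⁻¹) ^ 3 * Wr h g (φ (t * w))‖ ≤ (2 * L) * (3 / 2) ^ 3 := by
      rw [e]; exact mul_le_mul hk e3 (by positivity) (by positivity)
    have e5 : ‖(L:ℂ) ^ 2 * ((kk L a b h g (φ (t * w)))⁻¹) ^ 3 * Wr h g (φ (t * w))‖ ≤ 27 / 4 := by
      refine le_of_mul_le_mul_left (e4.trans_eq ?_) hL
      ring
    calc _ = ‖((L:ℂ) ^ 2 * ((kk L a b h g (φ (t * w)))⁻¹) ^ 3 * Wr h g (φ (t * w))) * w‖ := by congr 1; ring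
      _ = ‖(L:ℂ) ^ 2 * ((kk L a b h g (φ (t * w)))⁻¹) ^ 3 * Wr h g (φ (t * w))‖ * ‖w‖ := norm_mul _ _
      _ ≤ _ := mul_le_mul e5 hw8.le (norm_nonneg _) (by norm_num)
  have hmv := norm_image_sub_le_of_norm_deriv_right_le_segment (hfc.mono (Icc_subset_Icc_right hT.2))
    (fun t ht => (hd t ⟨ht.1, ht.2.le.trans hT.2⟩).hasDerivWithinAt) hb T ⟨hT.1, le_rfl⟩
  have hf0 : f 0 = 0 := by simp [hf, hφ, h0]
  rw [hf0, sub_zero, sub_zero] at hmv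
  nlinarith [hT.2, hT.1]

end Isl


namespace Isl
open Set Metric Filter Topology

theorem kk_diff {Ω : Set ℂ} {h g : ℂ → ℂ} (D : Data Ω h g) (L : ℝ) (a b : ℂ) :
    DifferentiableOn ℂ (kk L a b h g) Ω :=
  ((D.dh.const_mul _).add (D.dg.const_mul _)).const_mul _

theorem sol_unif {Ω : Set ℂ} {h g : ℂ → ℂ} (D : Data Ω h g) {L : ℝ} (hL : 0 < L) {a b x : ℂ}
    (u : ‖a‖ ^ 2 + ‖b‖ ^ 2 = 1) (h0 : rh L a b h g x = 0)
    (hκ : ∀ y, Step Ω (lm h g) (1 / L) x y → kap h g y ≤ 2 * L)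
    {r : ℝ} (hr : r ≤ 1 / 8) {φ : ℂ → ℂ} (hS : Sol Ω (kk L a b h g) (ball 0 r) φ) (hφ : φ 0 = x) :
    ∃ δ > 0, ∀ w ∈ ball (0:ℂ) r, ∃ ψ, Sol Ω (kk L a b h g) (ball w δ) ψ ∧ ψ w = φ w := by
  by_contra hcon
  push Not at hcon
  have hpos : ∀ n : ℕ, (0:ℝ) < 1 / ((n:ℝ) + 1) := fun n => by positivity
  choose w hw hbad using fun n : ℕ => hcon (1 / ((n:ℝ) + 1)) (hpos n)
  obtain ⟨w', -, σ, hσ, hlim⟩ := (isCompact_closedBall (0:ℂ) r).tendsto_subseq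
    (fun n => ball_subset_closedBall (hw n))
  obtain ⟨τ, hτ, hsum⟩ := Metric.exists_subseq_summable_dist_of_cauchySeq _ hlim.cauchySeq
  have hstep : ∀ i, Step Ω (lm h g) (3 / 2 * dist ((w ∘ σ) (τ (i + 1))) ((w ∘ σ) (τ i)) / L)
      (φ (w (σ (τ i)))) (φ (w (σ (τ (i + 1))))) := by
    intro i
    refine sol_step D hL u hS (fun t ht => ?_) (by rw [dist_eq_norm]; exact le_rfl)
    have hm := seg_ball (hw (σ (τ i))) (hw (σ (τ (i + 1)))) ht
    exact ⟨hm, (sol_bd D hL u h0 hκ hr hS hφ hm).le⟩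
  obtain ⟨y, hy, hyt⟩ := complete_lim D.op D.comp D.lm_cont (fun z hz => D.lm_pos hz) hstep
    ((hsum.mul_left (3 / 2)).div_const L)
  have hky : kk L a b h g y ≠ 0 := by
    have hc := ((kk_diff D L a b).continuousOn.continuousAt (D.op.mem_nhds hy)).tendsto.comp hyt
    have hc2 := (D.lm_cont.continuousAt (D.op.mem_nhds hy)).tendsto.comp hyt
    have hle : L * lm h g y ≤ 3 / 2 * ‖kk L a b h g y‖ := by
      refine le_of_tendsto_of_tendsto' (hc2.const_mul L) (hc.norm.const_mul (3 / 2)) (fun i => ?_)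
      obtain ⟨i1, i2, i3⟩ := hS _ (hw (σ (τ i)))
      have e := lm_eq hL u (rh_eqh u i2) (rh_eqg u i2)
      have e2 := sqrt_le_32 (sol_bd D hL u h0 hκ hr hS hφ (hw (σ (τ i)))).le
      rw [← e, norm_inv, ← div_eq_mul_inv, div_le_iff₀ (norm_pos_iff.2 i2)] at e2
      exact e2
    have := mul_pos hL (D.lm_pos hy)
    intro hz
    rw [hz, norm_zero] at hle
    linarith
  obtain ⟨δ, hδ, hev⟩ := sol_local D.op (kk_diff D L a b) hy hky
  have hδev : ∀ᶠ i : ℕ in atTop, 1 / (((σ (τ i) : ℕ):ℝ) + 1) < δ := by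
    have h1 := (tendsto_one_div_add_atTop_nhds_zero_nat (𝕜 := ℝ)).comp
      (hσ.tendsto_atTop.comp hτ.tendsto_atTop)
    exact h1.eventually (gt_mem_nhds hδ)
  obtain ⟨i, hi1, hi2⟩ := (hδev.and (hyt.eventually hev)).exists
  obtain ⟨ψ, hψ, hψ0⟩ := hi2 (w (σ (τ i)))
  exact hbad (σ (τ i)) ψ (hψ.mono (ball_subset_ball hi1.le)) hψ0

theorem chart_exists {Ω : Set ℂ} {h g : ℂ → ℂ} (D : Data Ω h g) {L : ℝ} (hL : 0 < L) {x : ℂ}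
    (hx : x ∈ Ω) (hκ : ∀ y, Step Ω (lm h g) (1 / L) x y → kap h g y ≤ 2 * L) :
    ∃ a b φ ρ, Chart Ω h g L x a b φ ρ := by
  have hlp := D.lm_pos hx
  have hlc : ((lm h g x : ℝ) : ℂ) ≠ 0 := by exact_mod_cast hlp.ne'
  have hsq : lm h g x ^ 2 = ‖h x‖ ^ 2 + ‖g x‖ ^ 2 := Real.sq_sqrt (by positivity)
  obtain ⟨a, ha⟩ : ∃ a, a = h x / lm h g x := ⟨_, rfl⟩
  obtain ⟨b, hb⟩ : ∃ b, b = g x / lm h g x := ⟨_, rfl⟩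
  have u : ‖a‖ ^ 2 + ‖b‖ ^ 2 = 1 := by
    rw [ha, hb]
    simp only [norm_div, Complex.norm_real, Real.norm_of_nonneg hlp.le]
    field_simp
    linarith
  have hha : h x = a * lm h g x := by rw [ha]; field_simp
  have hgb : g x = b * lm h g x := by rw [hb]; field_simp
  have hLc : (L:ℂ) ≠ 0 := by exact_mod_cast hL.ne'
  have hkx : kk L a b h g x ≠ 0 := by
    have : kk L a b h g x = L * lm h g x := by
      unfold kk; rw [hha, hgb]; linear_combination (L * lm h g x : ℂ) * unit_mul u
    rw [this]
    exact mul_ne_zero hLc hlc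
  have h0 : rh L a b h g x = 0 := by
    unfold rh; rw [hha, hgb]; ring
  obtain ⟨φ, hS, hφ⟩ := sol_global D.op (kk_diff D L a b) (c := 1 / 8) (by norm_num) hx hkx
    (fun R _ hRc φ hS hφ => sol_unif D hL u h0 hκ hRc hS hφ)
  have hbd := fun w hw => sol_bd D hL u h0 hκ le_rfl hS hφ (w := w) hw
  have hdφ : ∀ w ∈ ball (0:ℂ) (1 / 8), deriv φ w = (kk L a b h g (φ w))⁻¹ := fun w hw => (hS w hw).2.2.deriv
  have hdρ : ∀ w ∈ ball (0:ℂ) (1 / 8), HasDerivAt (fun w => rh L a b h g (φ w))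
      (L ^ 2 * ((kk L a b h g (φ w))⁻¹) ^ 2 * Wr h g (φ w) * (kk L a b h g (φ w))⁻¹) w := by
    intro w hw
    obtain ⟨i1, i2, i3⟩ := hS w hw
    exact (rh_der D u i1 i2).comp w i3
  refine ⟨a, b, φ, fun w => rh L a b h g (φ w), u, ?_, ?_, hφ, ?_, ?_, ?_, ?_, ?_, ?_, ?_, ?_⟩
  · exact fun w hw => (hS w hw).2.2.differentiableAt.differentiableWithinAt
  · exact fun w hw => (hS w hw).1
  · exact fun w hw => (hdρ w hw).differentiableAt.differentiableWithinAt
  · intro w hw; rw [hdφ w hw]; exact rh_eqh u (hS w hw).2.1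
  · intro w hw; rw [hdφ w hw]; exact rh_eqg u (hS w hw).2.1
  · intro w hw; rw [hdφ w hw, (hdρ w hw).deriv]; ring
  · intro w hw; rw [hdφ w hw]; exact inv_ne_zero (hS w hw).2.1
  · simp only [hφ, h0]
  · exact fun w hw => (hbd w hw).le
  · intro w hw
    have h00 : (0:ℂ) ∈ ball (0:ℂ) (1 / 8) := mem_ball_self (by norm_num)
    have := sol_step D hL u hS (w := 0) (w' := w) (l := 1 / L)
      (fun t ht => ⟨seg_ball h00 hw ht, (hbd _ (seg_ball h00 hw ht)).le⟩) (by
        rw [sub_zero]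
        apply div_le_div_of_nonneg_right _ hL.le
        have := mem_ball_zero_iff.1 hw
        linarith)
    rwa [hφ] at this

end Isl


namespace Isl
open Set Metric Filter Topology

theorem island_of_homeo {Ω : Set ℂ} {h g : ℂ → ℂ} (D : Data Ω h g) {φ : ℂ → ℂ}
    (e : OpenPartialHomeomorph ℂ ℂ) {α : ℂ} {ε : ℝ} (hε : 0 < ε) {K : Set ℂ} (hK : IsCompact K)
    (hsK : e.source ⊆ K) (hφK : ContinuousOn φ K) (hKΩ : ∀ w ∈ K, φ w ∈ Ω)
    (hst : ∀ w ∈ e.source, ∃ d, d ≠ 0 ∧ HasStrictDerivAt φ d w)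
    (hh : ∀ w ∈ e.source, h (φ w) ≠ 0) (hq : ∀ w ∈ e.source, g (φ w) / h (φ w) = e w)
    (ht : ball α ε ⊆ e.target) :
    ∃ W, IsIsland Ω h g (ball α ε) W ∧ InjOn (fun z => g z / h z) W := by
  set E : Set ℂ := {w ∈ Ω | h w ≠ 0 ∧ g w / h w ∈ ball α ε} with hE
  set T : ℂ → ℂ := fun v => φ (e.symm v) with hT
  set q : ℂ → ℂ := fun z => g z / h z with hqd
  set V : Set ℂ := T '' ball α ε with hV
  have hS : ∀ v ∈ ball α ε, e.symm v ∈ e.source := fun v hv => e.map_target (ht hv)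
  have hqT : ∀ v ∈ ball α ε, q (T v) = v := by
    intro v hv
    simp only [hqd, hT]
    rw [hq _ (hS v hv), e.right_inv (ht hv)]
  have hTE : ∀ v ∈ ball α ε, T v ∈ E := by
    intro v hv
    refine ⟨hKΩ _ (hsK (hS v hv)), hh _ (hS v hv), ?_⟩
    have := hqT v hv
    simp only [hqd] at this
    rw [this]; exact hv
  have hVE : V ⊆ E := by rintro _ ⟨v, hv, rfl⟩; exact hTE v hv
  have hTc : ContinuousOn T (ball α ε) :=
    hφK.comp (e.continuousOn_symm.mono ht) (fun v hv => hsK (hS v hv))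
  have hqc : ContinuousOn q (Ω ∩ {z | h z ≠ 0}) :=
    (D.dg.continuousOn.mono inter_subset_left).div (D.dh.continuousOn.mono inter_subset_left)
      (fun z hz => hz.2)
  have hop1 : IsOpen (Ω ∩ {z | h z ≠ 0}) :=
    D.dh.continuousOn.isOpen_inter_preimage D.op isOpen_ne
  have hEeq : E = (Ω ∩ {z | h z ≠ 0}) ∩ q ⁻¹' ball α ε := by
    ext z; simp only [hE, hqd, mem_ofPred_eq, mem_inter_iff, mem_preimage]; tauto
  have hEo : IsOpen E := by
    rw [hEeq]; exact hqc.isOpen_inter_preimage hop1 isOpen_ball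
  have hqE : ContinuousOn q E := hqc.mono (by rw [hEeq]; exact inter_subset_left)
  have hqm : ∀ z ∈ E, q z ∈ ball α ε := fun z hz => hz.2.2
  have hVchar : ∀ z ∈ E, (z ∈ V ↔ T (q z) - z = 0) := by
    intro z hz
    rw [sub_eq_zero]
    constructor
    · rintro ⟨v, hv, rfl⟩; rw [hqT v hv]
    · intro h1; exact ⟨q z, hqm z hz, h1⟩
  have hcont : ContinuousOn (fun z => T (q z) - z) E := (hTc.comp hqE hqm).sub continuousOn_id
  have hco : IsOpen (E ∩ (fun z => T (q z) - z) ⁻¹' {0}ᶜ) :=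
    hcont.isOpen_inter_preimage hEo isOpen_compl_singleton
  have hVo : IsOpen V := by
    rw [isOpen_iff_mem_nhds]
    rintro _ ⟨v, hv, rfl⟩
    obtain ⟨d, hd, hsd⟩ := hst _ (hS v hv)
    have hmap := hsd.map_nhds_eq hd
    change V ∈ 𝓝 (φ (e.symm v))
    rw [← hmap, Filter.mem_map]
    have h1 : ∀ᶠ w in 𝓝 (e.symm v), w ∈ e.source := e.open_source.eventually_mem (hS v hv)
    have h2 : ∀ᶠ w in 𝓝 (e.symm v), e w ∈ ball α ε := by
      have := (e.continuousAt (hS v hv)).eventually (p := fun y => y ∈ ball α ε)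
        (isOpen_ball.eventually_mem (by rw [e.right_inv (ht hv)]; exact hv))
      exact this
    filter_upwards [h1, h2] with w hw1 hw2
    exact ⟨e w, hw2, by simp only [hT]; rw [e.left_inv hw1]⟩
  have hVpre : IsPreconnected V := (convex_ball α ε).isPreconnected.image T hTc
  have hα : α ∈ ball α ε := mem_ball_self hε
  have hz0 : T α ∈ V := ⟨α, hα, rfl⟩
  have hcomp : V = connectedComponentIn E (T α) := by
    apply Subset.antisymm (hVpre.subset_connectedComponentIn hz0 hVE)
    refine isPreconnected_connectedComponentIn.subset_left_of_subset_union hVo hco ?_ ?_ ?_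
    · rw [Set.disjoint_left]
      intro z hz hz2
      exact hz2.2 ((hVchar z hz2.1).1 hz)
    · intro z hz
      have hzE := connectedComponentIn_subset _ _ hz
      by_cases hzV : z ∈ V
      · exact Or.inl hzV
      · exact Or.inr ⟨hzE, fun h1 => hzV ((hVchar z hzE).2 h1)⟩
    · exact ⟨T α, mem_connectedComponentIn (hVE hz0), hz0⟩
  have hsub : V ⊆ φ '' K := by
    rintro _ ⟨v, hv, rfl⟩
    exact ⟨e.symm v, hsK (hS v hv), rfl⟩
  have hcK : IsCompact (φ '' K) := hK.image_of_continuousOn hφK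
  have hclV : closure V ⊆ φ '' K := closure_minimal hsub hcK.isClosed
  refine ⟨V, ⟨⟨T α, hVE hz0, hcomp⟩, ?_, hcK.of_isClosed_subset isClosed_closure hclV, ?_⟩, ?_⟩
  · let H : ↥(ball α ε) ≃ₜ ↥V :=
      { toFun := fun v => ⟨T v, ⟨v, v.2, rfl⟩⟩
        invFun := fun z => ⟨q z, hqm z (hVE z.2)⟩
        left_inv := fun v => Subtype.ext (hqT v v.2)
        right_inv := fun z => Subtype.ext (sub_eq_zero.1 ((hVchar z (hVE z.2)).1 z.2))
        continuous_toFun := (continuousOn_iff_continuous_domRestrict.1 hTc).subtype_mk _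
        continuous_invFun := (continuousOn_iff_continuous_domRestrict.1 (hqE.mono hVE)).subtype_mk _ }
    have hb : ContractibleSpace ↥(ball α ε) := (convex_ball α ε).contractibleSpace ⟨α, hα⟩
    have hc : ContractibleSpace ↥V := H.contractibleSpace_iff.1 hb
    exact SimplyConnectedSpace.ofContractible ↥V
  · refine hclV.trans ?_
    rintro _ ⟨w, hw, rfl⟩
    exact hKΩ w hw
  · rintro _ ⟨v, hv, rfl⟩ _ ⟨v', hv', rfl⟩ heq
    have h1 : q (T v) = q (T v') := heq
    rw [hqT v hv, hqT v' hv'] at h1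
    rw [h1]

end Isl


namespace Isl
open Set Metric Filter Topology

theorem island_chart {Ω : Set ℂ} {h g : ℂ → ℂ} (D : Data Ω h g) {L : ℝ} (hL : 0 < L)
    {x a b : ℂ} {φ ρ : ℂ → ℂ} (C : Chart Ω h g L x a b φ ρ) {w0 α A : ℂ} {r ε : ℝ} (hr : 0 < r)
    (hε : 0 < ε) (hA : A ≠ 0) (hsub : closedBall w0 r ⊆ ball 0 (1 / 8))
    (hH : ∀ w ∈ ball w0 r, a - (starRingEnd ℂ) b * ρ w ≠ 0)
    (hd : ∀ w ∈ ball w0 r, ‖deriv ρ w / (a - (starRingEnd ℂ) b * ρ w) ^ 2 - A‖ ≤ ‖A‖ / 4)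
    (hα : ‖(b + (starRingEnd ℂ) a * ρ w0) / (a - (starRingEnd ℂ) b * ρ w0) - α‖ + ε ≤ ‖A‖ * r / 4) :
    ∃ W, IsIsland Ω h g (ball α ε) W ∧ InjOn (fun z => g z / h z) W := by
  have hbs : ∀ w ∈ ball w0 r, w ∈ ball (0:ℂ) (1 / 8) := fun w hw => hsub (ball_subset_closedBall hw)
  set R : ℂ → ℂ := fun w => (b + (starRingEnd ℂ) a * ρ w) / (a - (starRingEnd ℂ) b * ρ w) with hR
  have hRd : ∀ w ∈ ball w0 r, HasDerivAt R (deriv ρ w / (a - (starRingEnd ℂ) b * ρ w) ^ 2) w := by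
    intro w hw
    have h1 := (C.dρ.differentiableAt (isOpen_ball.mem_nhds (hbs w hw))).hasDerivAt
    have h2 := ((h1.const_mul ((starRingEnd ℂ) a)).const_add b).div
      ((h1.const_mul ((starRingEnd ℂ) b)).const_sub a) (hH w hw)
    refine HasDerivAt.congr_deriv h2 ?_
    congr 1
    linear_combination deriv ρ w * unit_mul C.unit
  let f' : ℂ ≃L[ℂ] ℂ := ContinuousLinearEquiv.unitsEquivAut ℂ (Units.mk0 A hA)
  have hf' : ∀ v, (f' : ℂ →L[ℂ] ℂ) v = v * A := fun v => by simp [f']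
  have hsymm : ∀ v, (f'.symm : ℂ →L[ℂ] ℂ) v = v * A⁻¹ := fun v => by simp [f']
  have hA0 : 0 < ‖A‖ := norm_pos_iff.2 hA
  have hN : ‖(f'.symm : ℂ →L[ℂ] ℂ)‖ = ‖A‖⁻¹ := by
    apply le_antisymm
    · refine ContinuousLinearMap.opNorm_le_bound _ (by positivity) fun v => ?_
      rw [hsymm, norm_mul, norm_inv, mul_comm]
    · have := (f'.symm : ℂ →L[ℂ] ℂ).le_opNorm 1
      rw [hsymm] at this
      simpa using this
  have hNinv : ((‖(f'.symm : ℂ →L[ℂ] ℂ)‖₊⁻¹ : NNReal) : ℝ) = ‖A‖ := by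
    rw [NNReal.coe_inv, coe_nnnorm, hN, inv_inv]
  have happ : ApproximatesLinearOn R (f' : ℂ →L[ℂ] ℂ) (ball w0 r) (‖A‖₊ / 4) := by
    intro y hy z hz
    have := (convex_ball w0 r).norm_image_sub_le_of_norm_hasDerivWithin_le
      (f := fun w => R w - w * A) (f' := fun w => deriv ρ w / (a - (starRingEnd ℂ) b * ρ w) ^ 2 - A)
      (C := ‖A‖ / 4) (fun w hw => by
        have := (hRd w hw).sub ((hasDerivAt_id w).mul_const A)
        rw [one_mul] at this
        exact this.hasDerivWithinAt) hd hz hy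
    rw [hf']
    push_cast
    calc ‖R y - R z - (y - z) * A‖ = ‖R y - y * A - (R z - z * A)‖ := by ring_nf
      _ ≤ _ := this
  have hc : Subsingleton ℂ ∨ ‖A‖₊ / 4 < ‖(f'.symm : ℂ →L[ℂ] ℂ)‖₊⁻¹ := by
    right
    rw [← NNReal.coe_lt_coe, hNinv]
    push_cast
    linarith
  have htgt := happ.closedBall_subset_target hc isOpen_ball (b := w0) (ε := r / 2) (by positivity)
    (closedBall_subset_ball (by linarith))
  refine island_of_homeo D (φ := φ) (happ.toOpenPartialHomeomorph R (ball w0 r) hc isOpen_ball) hε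
    (isCompact_closedBall w0 r) ?_ (C.dφ.continuousOn.mono hsub) (fun w hw => C.maps w (hsub hw))
    ?_ ?_ ?_ ?_
  · exact ball_subset_closedBall
  · intro w hw
    have hw := hbs w hw
    exact ⟨deriv φ w, C.ne w hw, (C.dφ.analyticAt (isOpen_ball.mem_nhds hw)).hasStrictDerivAt⟩
  · intro w hw h0
    have := C.eqh w (hbs w hw)
    rw [h0, mul_zero, zero_mul] at this
    exact hH w hw this.symm
  · intro w hw
    have hLc : (L:ℂ) ≠ 0 := by exact_mod_cast hL.ne'
    change _ = R w
    simp only [hR]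
    rw [← C.eqh w (hbs w hw), ← C.eqg w (hbs w hw)]
    rw [mul_div_mul_right _ _ (C.ne w (hbs w hw)), mul_div_mul_left _ _ hLc]
  · refine Subset.trans ?_ htgt
    intro v hv
    rw [mem_closedBall, dist_eq_norm, hNinv]
    push_cast
    rw [mem_ball, dist_eq_norm] at hv
    have : ‖v - R w0‖ ≤ ‖R w0 - α‖ + ‖v - α‖ := by
      rw [show v - R w0 = (v - α) - (R w0 - α) by ring]
      linarith [norm_sub_le (v - α) (R w0 - α)]
    have h3 := mul_pos hA0 hr
    nlinarith

theorem island_limit {U : Filter ℕ} [U.NeBot] {Ω : ℕ → Set ℂ} {h g : ℕ → ℂ → ℂ} {L ε : ℕ → ℝ}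
    {x a b : ℕ → ℂ} {φ ρ : ℕ → ℂ → ℂ} {a0 b0 α : ℂ} {F : ℂ → ℂ}
    (hD : ∀ n, Data (Ω n) (h n) (g n)) (hL : ∀ n, 0 < L n) (hε : ∀ n, 0 < ε n)
    (hC : ∀ᶠ n in U, Chart (Ω n) (h n) (g n) (L n) (x n) (a n) (b n) (φ n) (ρ n))
    (hno : ∀ n, ∀ W, IsIsland (Ω n) (h n) (g n) (ball α (ε n)) W →
      ¬ InjOn (fun z => g n z / h n z) W)
    (hε0 : Tendsto ε U (𝓝 0)) (ha : Tendsto a U (𝓝 a0)) (hb : Tendsto b U (𝓝 b0))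
    (u : ‖a0‖ ^ 2 + ‖b0‖ ^ 2 = 1)
    (hρ : CC U ρ F (ball 0 (1 / 8))) (hρ' : CC U (fun n => deriv (ρ n)) (deriv F) (ball 0 (1 / 8)))
    {w0 : ℂ} (hw0 : w0 ∈ ball (0:ℂ) (1 / 8)) (hlin : lin α a0 b0 (F w0) = 0) : deriv F w0 = 0 := by
  by_contra hne
  have hH0 : a0 - (starRingEnd ℂ) b0 * F w0 ≠ 0 := by
    intro h0
    rw [lin_eq, h0, mul_zero, sub_zero] at hlin
    have := frame_norm a0 b0 (F w0) u
    rw [h0, hlin, norm_zero] at this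
    have h2 := sq_nonneg ‖F w0‖
    linarith
  obtain ⟨A, hAdef⟩ : ∃ A, A = deriv F w0 / (a0 - (starRingEnd ℂ) b0 * F w0) ^ 2 := ⟨_, rfl⟩
  have hA : A ≠ 0 := by rw [hAdef]; exact div_ne_zero hne (pow_ne_zero 2 hH0)
  have hA0 : 0 < ‖A‖ := norm_pos_iff.2 hA
  have hR0 : (b0 + (starRingEnd ℂ) a0 * F w0) / (a0 - (starRingEnd ℂ) b0 * F w0) = α := by
    rw [lin_eq, sub_eq_zero] at hlin
    rw [hlin, mul_div_assoc, div_self hH0, mul_one]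
  have hconj : ∀ {V : Filter (ℕ × ℂ)} {f : ℕ × ℂ → ℂ} {c : ℂ}, Tendsto f V (𝓝 c) →
      Tendsto (fun p => (starRingEnd ℂ) (f p)) V (𝓝 ((starRingEnd ℂ) c)) :=
    fun hf => (Complex.continuous_conj.tendsto _).comp hf
  have ta : Tendsto (fun p : ℕ × ℂ => a p.1) (U ×ˢ 𝓝 w0) (𝓝 a0) := ha.comp tendsto_fst
  have tb : Tendsto (fun p : ℕ × ℂ => b p.1) (U ×ˢ 𝓝 w0) (𝓝 b0) := hb.comp tendsto_fst
  have tρ := hρ w0 hw0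
  have tρ' := hρ' w0 hw0
  have tH : Tendsto (fun p : ℕ × ℂ => a p.1 - (starRingEnd ℂ) (b p.1) * ρ p.1 p.2) (U ×ˢ 𝓝 w0)
      (𝓝 (a0 - (starRingEnd ℂ) b0 * F w0)) := ta.sub ((hconj tb).mul tρ)
  have tG : Tendsto (fun p : ℕ × ℂ => b p.1 + (starRingEnd ℂ) (a p.1) * ρ p.1 p.2) (U ×ˢ 𝓝 w0)
      (𝓝 (b0 + (starRingEnd ℂ) a0 * F w0)) := tb.add ((hconj ta).mul tρ)
  have tR := tG.div tH hH0
  rw [hR0] at tR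
  have tA := tρ'.div (tH.pow 2) (pow_ne_zero 2 hH0)
  rw [← hAdef] at tA
  have e1 := tH.eventually_ne hH0
  have e2 : ∀ᶠ p in U ×ˢ 𝓝 w0, _ := tA.eventually (closedBall_mem_nhds A (show 0 < ‖A‖ / 4 by positivity))
  obtain ⟨P, hP, Q, hQ, hPQ⟩ := eventually_prod_iff.1 (e1.and e2)
  have hQ2 := hQ.and (isOpen_ball.eventually_mem hw0)
  obtain ⟨r2, hr2, hball⟩ := Metric.eventually_nhds_iff_ball.1 hQ2
  obtain ⟨r, hrdef⟩ : ∃ r, r = r2 / 2 := ⟨_, rfl⟩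
  have hr : 0 < r := by rw [hrdef]; positivity
  have hsub : closedBall w0 r ⊆ ball w0 r2 := closedBall_subset_ball (by rw [hrdef]; linarith)
  have tpt : Tendsto (fun n : ℕ => ((n, w0) : ℕ × ℂ)) U (U ×ˢ 𝓝 w0) :=
    tendsto_id.prodMk tendsto_const_nhds
  have tlast := ((tR.comp tpt).sub_const α).norm.add hε0
  rw [sub_self, norm_zero, zero_add] at tlast
  have e3 := tlast.eventually (gt_mem_nhds (show 0 < ‖A‖ * r / 4 by positivity))
  obtain ⟨n, hCn, hPn, h3⟩ := (hC.and (hP.and e3)).exists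
  obtain ⟨W, hW, hWi⟩ := island_chart (hD n) (hL n) hCn hr (hε n) hA
    (fun w hw => (hball w (hsub hw)).2)
    (fun w hw => (hPQ hPn (hball w (hsub (ball_subset_closedBall hw))).1).1)
    (fun w hw => by
      have := (hPQ hPn (hball w (hsub (ball_subset_closedBall hw))).1).2
      exact (dist_eq_norm _ _).symm.le.trans this) h3.le
  exact hno n W hW hWi

end Isl


namespace Isl
open Set Metric Filter Topology

theorem dep_aux {Ω : Set ℂ} {h g : ℂ → ℂ} (hΩ : IsOpen Ω) (hc : IsPreconnected Ω)
    (dh : DifferentiableOn ℂ h Ω) (dg : DifferentiableOn ℂ g Ω) (hW : ∀ z ∈ Ω, Wr h g z = 0)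
    {z0 : ℂ} (hz0 : z0 ∈ Ω) (hh : h z0 ≠ 0) : ∀ z ∈ Ω, h z0 * g z + (-g z0) * h z = 0 := by
  have ev : ∀ᶠ z in 𝓝 z0, z ∈ Ω ∧ h z ≠ 0 := (hΩ.eventually_mem hz0).and
    ((dh.continuousOn.continuousAt (hΩ.mem_nhds hz0)).eventually_ne hh)
  obtain ⟨r, hr, hb⟩ := Metric.eventually_nhds_iff_ball.1 ev
  have hq : ∀ z ∈ ball z0 r, HasDerivAt (fun z => g z / h z) 0 z := by
    intro z hz
    obtain ⟨i1, i2⟩ := hb z hz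
    have h1 := (dh.differentiableAt (hΩ.mem_nhds i1)).hasDerivAt
    have h2 := (dg.differentiableAt (hΩ.mem_nhds i1)).hasDerivAt
    refine HasDerivAt.congr_deriv (h2.div h1 i2) ?_
    have := hW z i1
    unfold Wr at this
    rw [div_eq_zero_iff]
    left
    linear_combination this
  have hconst : ∀ z ∈ ball z0 r, g z / h z = g z0 / h z0 := by
    intro z hz
    exact isOpen_ball.is_const_of_deriv_eq_zero (convex_ball z0 r).isPreconnected
      (fun w hw => (hq w hw).differentiableAt.differentiableWithinAt)
      (fun w hw => (hq w hw).deriv) hz (mem_ball_self hr)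
  have ha : AnalyticOnNhd ℂ (fun z => h z0 * g z + (-g z0) * h z) Ω :=
    DifferentiableOn.analyticOnNhd ((dg.const_mul _).add (dh.const_mul _)) hΩ
  refine ha.eqOn_zero_of_preconnected_of_eventuallyEq_zero hc hz0 ?_
  filter_upwards [ball_mem_nhds z0 hr] with z hz
  have h1 := hconst z hz
  rw [div_eq_div_iff (hb z hz).2 hh] at h1
  simp only [Pi.zero_apply]
  linear_combination h1

theorem dep {Ω : Set ℂ} {h g : ℂ → ℂ} (D : Data Ω h g) (hc : IsPreconnected Ω)
    (hne : Ω.Nonempty) (hW : ∀ z ∈ Ω, Wr h g z = 0) :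
    ∃ a b : ℂ, ¬(a = 0 ∧ b = 0) ∧ ∀ z ∈ Ω, a * g z + b * h z = 0 := by
  obtain ⟨z0, hz0⟩ := hne
  rcases D.nz z0 hz0 with h1 | h1
  · exact ⟨h z0, -g z0, fun h2 => h1 h2.1, dep_aux D.op hc D.dh D.dg hW hz0 h1⟩
  · have := dep_aux D.op hc D.dg D.dh (fun z hz => by
      have := hW z hz
      unfold Wr at *
      linear_combination -this) hz0 h1
    exact ⟨-h z0, g z0, fun h2 => h1 h2.2, fun z hz => by linear_combination this z hz⟩

/-- A sequence of counterexamples, rescaled. -/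
structure Sq (α : Fin 7 → ℂ) (Ω : ℕ → Set ℂ) (h g : ℕ → ℂ → ℂ) (L ε : ℕ → ℝ) (q : ℕ → ℂ) : Prop where
  data : ∀ n, Data (Ω n) (h n) (g n)
  Lpos : ∀ n, 0 < L n
  εpos : ∀ n, 0 < ε n
  ε0 : Tendsto ε atTop (𝓝 0)
  qmem : ∀ n, q n ∈ Ω n
  kq : ∀ n, kap (h n) (g n) (q n) = L n
  pick : ∀ n y, Reach (Ω n) (lm (h n) (g n)) n (1 / L n) (q n) y → kap (h n) (g n) y ≤ 2 * L n
  no : ∀ n j W, IsIsland (Ω n) (h n) (g n) (ball (α j) (ε n)) W → ¬ InjOn (fun z => g n z / h n z) W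

/-- Limit of charts along the hyperfilter. -/
structure Lmt (Ω : ℕ → Set ℂ) (h g : ℕ → ℂ → ℂ) (L : ℕ → ℝ) (x a' b' : ℕ → ℂ)
    (φ ρ : ℕ → ℂ → ℂ) (a b : ℂ) (F : ℂ → ℂ) : Prop where
  chart : ∀ᶠ n in (hyperfilter ℕ : Filter ℕ), Chart (Ω n) (h n) (g n) (L n) (x n) (a' n) (b' n) (φ n) (ρ n)
  ta : Tendsto a' (hyperfilter ℕ : Filter ℕ) (𝓝 a)
  tb : Tendsto b' (hyperfilter ℕ : Filter ℕ) (𝓝 b)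
  cc : CC (hyperfilter ℕ : Filter ℕ) ρ F (ball 0 (1 / 8))
  cc' : CC (hyperfilter ℕ : Filter ℕ) (fun n => deriv (ρ n)) (deriv F) (ball 0 (1 / 8))
  diff : DifferentiableOn ℂ F (ball 0 (1 / 8))
  bd : ∀ w ∈ ball (0:ℂ) (1 / 8), ‖F w‖ ≤ 1

theorem ultra_bdd (U : Ultrafilter ℕ) (a : ℕ → ℂ) (B : ℝ) (ha : ∀ᶠ n in (U : Filter ℕ), ‖a n‖ ≤ B) :
    ∃ y, Tendsto a U (𝓝 y) := by
  have hc := isCompact_closedBall (0 : ℂ) B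
  have : closedBall (0 : ℂ) B ∈ U.map a := by
    rw [Ultrafilter.mem_map]
    filter_upwards [ha] with n hn
    simpa using hn
  obtain ⟨y, _, hy⟩ := hc.ultrafilter_le_nhds (U.map a) (by simpa using this)
  exact ⟨y, hy⟩

theorem ev_hyper {p : ℕ → Prop} (h : ∀ᶠ n in atTop, p n) : ∀ᶠ n in (hyperfilter ℕ : Filter ℕ), p n :=
  Nat.hyperfilter_le_atTop h

theorem exists_lim {α : Fin 7 → ℂ} {Ω : ℕ → Set ℂ} {h g : ℕ → ℂ → ℂ} {L ε : ℕ → ℝ} {q : ℕ → ℂ}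
    (S : Sq α Ω h g L ε q) {m : ℕ} {x : ℕ → ℂ} (hx : ∀ᶠ n in (hyperfilter ℕ : Filter ℕ),
      Reach (Ω n) (lm (h n) (g n)) m (1 / L n) (q n) (x n)) :
    ∃ a' b' φ ρ a b F, Lmt Ω h g L x a' b' φ ρ a b F := by
  have hex : ∀ n, ∃ a b φ ρ, (m + 1 ≤ n ∧ Reach (Ω n) (lm (h n) (g n)) m (1 / L n) (q n) (x n)) →
      Chart (Ω n) (h n) (g n) (L n) (x n) a b φ ρ := by
    intro n
    by_cases hp : m + 1 ≤ n ∧ Reach (Ω n) (lm (h n) (g n)) m (1 / L n) (q n) (x n)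
    · obtain ⟨a, b, φ, ρ, hC⟩ := chart_exists (S.data n) (S.Lpos n) (hp.2.mem (S.qmem n))
        (fun y hy => S.pick n y ((hp.2.succ hy).mono (S.qmem n) (by have := S.Lpos n; positivity) hp.1))
      exact ⟨a, b, φ, ρ, fun _ => hC⟩
    · exact ⟨0, 0, id, id, fun h => absurd h hp⟩
  choose a' b' φ ρ hC using hex
  have hch : ∀ᶠ n in (hyperfilter ℕ : Filter ℕ),
      Chart (Ω n) (h n) (g n) (L n) (x n) (a' n) (b' n) (φ n) (ρ n) := by
    filter_upwards [hx, ev_hyper (eventually_ge_atTop (m + 1))] with n h1 h2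
    exact hC n ⟨h2, h1⟩
  obtain ⟨a, ha⟩ := ultra_bdd (hyperfilter ℕ) a' 1 (hch.mono fun n hn => by
    have := hn.unit; nlinarith [norm_nonneg (a' n), sq_nonneg ‖b' n‖])
  obtain ⟨b, hb⟩ := ultra_bdd (hyperfilter ℕ) b' 1 (hch.mono fun n hn => by
    have := hn.unit; nlinarith [norm_nonneg (b' n), sq_nonneg ‖a' n‖])
  obtain ⟨F, h1, h2, h3, h4⟩ := ultra_montel (hyperfilter ℕ) ρ (1 / 8) 1 (hch.mono fun n hn => hn.dρ)
    (hch.mono fun n hn => hn.bd)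
  exact ⟨a', b', φ, ρ, a, b, F, hch, ha, hb, h2, h3, h1, h4⟩

theorem zero_mem8 : (0:ℂ) ∈ ball (0:ℂ) (1 / 8) := mem_ball_self (by norm_num)

theorem lim_trip {α : Fin 7 → ℂ} {Ω : ℕ → Set ℂ} {h g : ℕ → ℂ → ℂ} {L ε : ℕ → ℝ} {q : ℕ → ℂ}
    (S : Sq α Ω h g L ε q) {x a' b' : ℕ → ℂ} {φ ρ : ℕ → ℂ → ℂ} {a b : ℂ} {F : ℂ → ℂ}
    (M : Lmt Ω h g L x a' b' φ ρ a b F) : Trip α a b F := by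
  have hu : ‖a‖ ^ 2 + ‖b‖ ^ 2 = 1 := by
    have h1 := (M.ta.norm.pow 2).add (M.tb.norm.pow 2)
    refine tendsto_nhds_unique h1 (tendsto_const_nhds.congr' ?_)
    filter_upwards [M.chart] with n hn
    exact hn.unit.symm
  refine ⟨hu, M.diff, M.bd, ?_, ?_⟩
  · refine tendsto_nhds_unique (M.cc.at zero_mem8) (tendsto_const_nhds.congr' ?_)
    filter_upwards [M.chart] with n hn
    exact hn.ρ0.symm
  · intro j w hw hl
    exact island_limit S.data S.Lpos S.εpos M.chart (fun n W hW => S.no n j W hW)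
      (S.ε0.mono_left Nat.hyperfilter_le_atTop) M.ta M.tb hu M.cc M.cc' hw hl

theorem chart_lin {Ω : Set ℂ} {h g : ℂ → ℂ} {L : ℝ} (hL : 0 < L) {x a b : ℂ} {φ ρ : ℂ → ℂ}
    (C : Chart Ω h g L x a b φ ρ) {w : ℂ} (hw : w ∈ ball (0:ℂ) (1 / 8)) (α : ℂ) :
    ‖lin α a b (ρ w)‖ = L * ‖deriv φ w‖ * ‖g (φ w) - α * h (φ w)‖ := by
  rw [lin_eq, ← C.eqh w hw, ← C.eqg w hw]
  rw [show L * g (φ w) * deriv φ w - α * (L * h (φ w) * deriv φ w) =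
    L * deriv φ w * (g (φ w) - α * h (φ w)) by ring]
  rw [norm_mul, norm_mul, Complex.norm_real, Real.norm_of_nonneg hL.le]

theorem chart_NN {Ω : Set ℂ} {h g : ℂ → ℂ} {L : ℝ} (hL : 0 < L) {x a b : ℂ} {φ ρ : ℂ → ℂ}
    (C : Chart Ω h g L x a b φ ρ) {w : ℂ} (hw : w ∈ ball (0:ℂ) (1 / 8)) (α : Fin 7 → ℂ) :
    NN α a b (ρ w) (deriv ρ w) =
      ‖Wr h g (φ w)‖ ^ 2 * lm h g (φ w) / (L ^ 2 * ∏ j, ‖g (φ w) - α j * h (φ w)‖) := by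
  have hd := norm_pos_iff.2 (C.ne w hw)
  unfold NN
  rw [← lm_eq hL C.unit (C.eqh w hw) (C.eqg w hw)]
  simp only [chart_lin hL C hw, Finset.prod_mul_distrib, Finset.prod_const, Finset.card_univ,
    Fintype.card_fin]
  rw [C.der w hw]
  simp only [norm_mul, norm_pow, Complex.norm_real, Real.norm_of_nonneg hL.le]
  rw [show (L ^ 2 * ‖deriv φ w‖ ^ 3 * ‖Wr h g (φ w)‖) ^ 2 * (L * lm h g (φ w) * ‖deriv φ w‖)
    = (L ^ 5 * ‖deriv φ w‖ ^ 7) * (‖Wr h g (φ w)‖ ^ 2 * lm h g (φ w)) by ring,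
    show L ^ 7 * ‖deriv φ w‖ ^ 7 * ∏ j, ‖g (φ w) - α j * h (φ w)‖
    = (L ^ 5 * ‖deriv φ w‖ ^ 7) * (L ^ 2 * ∏ j, ‖g (φ w) - α j * h (φ w)‖) by ring,
    mul_div_mul_left _ _ (by positivity)]

theorem chart_ratio {Ω : Set ℂ} {h g : ℂ → ℂ} {L : ℝ} (hL : 0 < L) {x a b : ℂ} {φ ρ : ℂ → ℂ}
    (C : Chart Ω h g L x a b φ ρ) {w : ℂ} (hw : w ∈ ball (0:ℂ) (1 / 8)) (α : ℂ) :
    ‖lin α a b (ρ w)‖ / Real.sqrt (1 + ‖ρ w‖ ^ 2) = ‖g (φ w) - α * h (φ w)‖ / lm h g (φ w) := by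
  have hd := norm_pos_iff.2 (C.ne w hw)
  rw [chart_lin hL C hw, ← lm_eq hL C.unit (C.eqh w hw) (C.eqg w hw),
    show L * lm h g (φ w) * ‖deriv φ w‖ = L * ‖deriv φ w‖ * lm h g (φ w) by ring,
    mul_div_mul_left _ _ (by positivity)]

theorem Lmt.tlin {Ω : ℕ → Set ℂ} {h g : ℕ → ℂ → ℂ} {L : ℕ → ℝ}
    {x a' b' : ℕ → ℂ} {φ ρ : ℕ → ℂ → ℂ} {a b : ℂ} {F : ℂ → ℂ}
    (M : Lmt Ω h g L x a' b' φ ρ a b F) {w : ℂ} (hw : w ∈ ball (0:ℂ) (1 / 8)) (α : ℂ) :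
    Tendsto (fun n => ‖lin α (a' n) (b' n) (ρ n w)‖) (hyperfilter ℕ : Filter ℕ)
      (𝓝 ‖lin α a b (F w)‖) := by
  have hconj : ∀ {f : ℕ → ℂ} {c : ℂ}, Tendsto f (hyperfilter ℕ : Filter ℕ) (𝓝 c) →
      Tendsto (fun p => (starRingEnd ℂ) (f p)) (hyperfilter ℕ : Filter ℕ) (𝓝 ((starRingEnd ℂ) c)) :=
    fun hf => (Complex.continuous_conj.tendsto _).comp hf
  unfold lin
  exact ((M.tb.sub (M.ta.const_mul α)).add
    (((hconj M.ta).add ((hconj M.tb).const_mul α)).mul (M.cc.at hw))).norm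

theorem Lmt.tsqrt {Ω : ℕ → Set ℂ} {h g : ℕ → ℂ → ℂ} {L : ℕ → ℝ}
    {x a' b' : ℕ → ℂ} {φ ρ : ℕ → ℂ → ℂ} {a b : ℂ} {F : ℂ → ℂ}
    (M : Lmt Ω h g L x a' b' φ ρ a b F) {w : ℂ} (hw : w ∈ ball (0:ℂ) (1 / 8)) :
    Tendsto (fun n => Real.sqrt (1 + ‖ρ n w‖ ^ 2)) (hyperfilter ℕ : Filter ℕ)
      (𝓝 (Real.sqrt (1 + ‖F w‖ ^ 2))) :=
  (((M.cc.at hw).norm.pow 2).const_add 1).sqrt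

theorem Lmt.tNN {Ω : ℕ → Set ℂ} {h g : ℕ → ℂ → ℂ} {L : ℕ → ℝ}
    {x a' b' : ℕ → ℂ} {φ ρ : ℕ → ℂ → ℂ} {a b : ℂ} {F : ℂ → ℂ}
    (M : Lmt Ω h g L x a' b' φ ρ a b F) {w : ℂ} (hw : w ∈ ball (0:ℂ) (1 / 8)) (α : Fin 7 → ℂ)
    (hne : ∀ j, lin (α j) a b (F w) ≠ 0) :
    Tendsto (fun n => NN α (a' n) (b' n) (ρ n w) (deriv (ρ n) w)) (hyperfilter ℕ : Filter ℕ)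
      (𝓝 (NN α a b (F w) (deriv F w))) := by
  unfold NN
  refine (((M.cc'.at hw).norm.pow 2).mul (M.tsqrt hw)).div
    (tendsto_finsetProd _ fun j _ => M.tlin hw (α j)) ?_
  exact Finset.prod_ne_zero_iff.2 fun j _ => norm_ne_zero_iff.2 (hne j)

theorem sqrt_pos1 (r : ℂ) : 0 < Real.sqrt (1 + ‖r‖ ^ 2) := Real.sqrt_pos.2 (by positivity)

theorem recentre {α : Fin 7 → ℂ} {Ω : ℕ → Set ℂ} {h g : ℕ → ℂ → ℂ} {L ε : ℕ → ℝ} {q : ℕ → ℂ}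
    (S : Sq α Ω h g L ε q) {x a' b' : ℕ → ℂ} {φ ρ : ℕ → ℂ → ℂ} {a b : ℂ} {F : ℂ → ℂ}
    (M : Lmt Ω h g L x a' b' φ ρ a b F) {w : ℂ} (hw : w ∈ ball (0:ℂ) (1 / 8))
    (hN : NN α a b (F w) (deriv F w) ≠ 0)
    {a2' b2' : ℕ → ℂ} {φ2 ρ2 : ℕ → ℂ → ℂ} {a2 b2 : ℂ} {F2 : ℂ → ℂ}
    (M2 : Lmt Ω h g L (fun n => φ n w) a2' b2' φ2 ρ2 a2 b2 F2) :
    NN α a2 b2 0 (deriv F2 0) = NN α a b (F w) (deriv F w) := by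
  have hlin : ∀ j, lin (α j) a b (F w) ≠ 0 := by
    have : ∏ j, ‖lin (α j) a b (F w)‖ ≠ 0 := fun h0 => hN (by unfold NN; rw [h0, div_zero])
    intro j
    exact norm_ne_zero_iff.1 (Finset.prod_ne_zero_iff.1 this j (Finset.mem_univ j))
  have hF20 : F2 0 = 0 := (lim_trip S M2).zero
  have hlin2 : ∀ j, lin (α j) a2 b2 (F2 0) ≠ 0 := by
    intro j
    have t1 := (M.tlin hw (α j)).div (M.tsqrt hw) (sqrt_pos1 _).ne'
    have t2 := (M2.tlin zero_mem8 (α j)).div (M2.tsqrt zero_mem8) (sqrt_pos1 _).ne'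
    have heq : ‖lin (α j) a b (F w)‖ / Real.sqrt (1 + ‖F w‖ ^ 2) =
        ‖lin (α j) a2 b2 (F2 0)‖ / Real.sqrt (1 + ‖F2 0‖ ^ 2) := by
      refine tendsto_nhds_unique t1 (t2.congr' ?_)
      filter_upwards [M.chart, M2.chart] with n h1 h2
      simp only [Pi.div_apply]
      rw [chart_ratio (S.Lpos n) h1 hw, chart_ratio (S.Lpos n) h2 zero_mem8, h2.φ0]
    intro h0
    rw [h0, norm_zero, zero_div] at heq
    have := div_pos (norm_pos_iff.2 (hlin j)) (sqrt_pos1 (F w))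
    linarith
  have t1 := M.tNN hw α hlin
  have t2 := M2.tNN zero_mem8 α hlin2
  rw [hF20] at t2
  refine tendsto_nhds_unique t2 (t1.congr' ?_)
  filter_upwards [M.chart, M2.chart] with n h1 h2
  rw [chart_NN (S.Lpos n) h1 hw, chart_NN (S.Lpos n) h2 zero_mem8, h2.φ0]

theorem no_Sq {α : Fin 7 → ℂ} (hα : Function.Injective α) {Ω : ℕ → Set ℂ} {h g : ℕ → ℂ → ℂ}
    {L ε : ℕ → ℝ} {q : ℕ → ℂ} (S : Sq α Ω h g L ε q) : False := by
  refine abstract_thm α hα (fun a b F => (∃ (m : ℕ) (x a' b' : ℕ → ℂ) (φ ρ : ℕ → ℂ → ℂ),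
    (∀ᶠ n in (hyperfilter ℕ : Filter ℕ), Reach (Ω n) (lm (h n) (g n)) m (1 / L n) (q n) (x n)) ∧
    Lmt Ω h g L x a' b' φ ρ a b F) ∧ ∃ w ∈ ball (0:ℂ) (1 / 8), deriv F w ≠ 0) ?_ ?_ ?_ ?_
  · rintro a b F ⟨⟨m, x, a', b', φ, ρ, -, M⟩, -⟩
    exact lim_trip S M
  · rintro a b F ⟨-, h2⟩
    exact h2
  · rintro a b F ⟨⟨m, x, a', b', φ, ρ, hR, M⟩, -⟩ w hw hN
    have hR2 : ∀ᶠ n in (hyperfilter ℕ : Filter ℕ),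
        Reach (Ω n) (lm (h n) (g n)) (m + 1) (1 / L n) (q n) (φ n w) := by
      filter_upwards [hR, M.chart] with n h1 h2
      exact h1.succ (h2.step w hw)
    obtain ⟨a2', b2', φ2, ρ2, a2, b2, F2, M2⟩ := exists_lim S hR2
    have hE := recentre S M hw hN M2
    refine ⟨a2, b2, F2, ⟨⟨m + 1, _, a2', b2', φ2, ρ2, hR2, M2⟩, 0, zero_mem8, ?_⟩, hE⟩
    intro h0
    rw [h0] at hE
    apply hN
    rw [← hE]
    simp [NN]
  · have hR : ∀ᶠ n in (hyperfilter ℕ : Filter ℕ),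
        Reach (Ω n) (lm (h n) (g n)) 0 (1 / L n) (q n) (q n) := Eventually.of_forall fun n => reach_zero
    obtain ⟨a', b', φ, ρ, a, b, F, M⟩ := exists_lim S hR
    refine ⟨a, b, F, ⟨0, q, a', b', φ, ρ, hR, M⟩, 0, zero_mem8, ?_⟩
    have t := (M.cc'.at zero_mem8).norm
    have : ‖deriv F 0‖ = 1 := by
      refine tendsto_nhds_unique t (tendsto_const_nhds.congr' ?_)
      filter_upwards [M.chart] with n hn
      have e := kap_eq (S.Lpos n) hn.unit ((S.data n).lm_pos (hn.maps 0 zero_mem8)) (hn.ne 0 zero_mem8)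
        (hn.eqh 0 zero_mem8) (hn.eqg 0 zero_mem8) (hn.der 0 zero_mem8)
      rw [hn.φ0, S.kq, hn.ρ0] at e
      simp only [norm_zero, ne_eq, OfNat.ofNat_ne_zero, not_false_eq_true, zero_pow, add_zero,
        Real.sqrt_one, one_pow, mul_one] at e
      have hL := S.Lpos n
      exact (mul_left_cancel₀ hL.ne' (e.trans (mul_one _).symm)).symm
    intro h0
    rw [h0, norm_zero] at this
    exact zero_ne_one this

end Isl

theorem islands_theorem_for_ratio
    (α : Fin 7 → ℂ) (hα : Function.Injective α) :
    ∃ ε : ℝ, 0 < ε ∧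
      ∀ (Ω : Set ℂ) (h g : ℂ → ℂ),
        Ω.Nonempty → IsOpen Ω → SimplyConnectedSpace ↥Ω →
        DifferentiableOn ℂ h Ω → DifferentiableOn ℂ g Ω →
        (∀ z ∈ Ω, h z ≠ 0 ∨ g z ≠ 0) →
        MetricComplete Ω (fun z => Real.sqrt (‖h z‖ ^ 2 + ‖g z‖ ^ 2)) →
        (∀ j : Fin 7, ∀ W : Set ℂ, IsIsland Ω h g (Metric.ball (α j) ε) W →
          ¬ Set.InjOn (fun z => g z / h z) W) →
        ∃ a b : ℂ, ¬(a = 0 ∧ b = 0) ∧ ∀ z ∈ Ω, a * g z + b * h z = 0 := by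
  by_contra hcon
  push Not at hcon
  choose Ω h g hne hop hsc dh dg hnz hcomp hno hbad using
    fun n : ℕ => hcon (1 / ((n:ℝ) + 1)) (by positivity)
  have hD : ∀ n, Isl.Data (Ω n) (h n) (g n) := fun n => ⟨hop n, dh n, dg n, hnz n, hcomp n⟩
  have hpick : ∀ n, ∃ q ∈ Ω n, 0 < Isl.kap (h n) (g n) q ∧
      ∀ y, Isl.Reach (Ω n) (Isl.lm (h n) (g n)) n (1 / Isl.kap (h n) (g n) q) q y →
        Isl.kap (h n) (g n) y ≤ 2 * Isl.kap (h n) (g n) q := by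
    intro n
    have hW : ∃ z ∈ Ω n, Isl.Wr (h n) (g n) z ≠ 0 := by
      by_contra hW
      push Not at hW
      have hsc' := hsc n
      have hpre : IsPreconnected (Ω n) := isPreconnected_iff_preconnectedSpace.2 inferInstance
      obtain ⟨a, b, hab, h0⟩ := Isl.dep (hD n) hpre (hne n) hW
      obtain ⟨z, hz, hz0⟩ := hbad n a b (fun ha hb => hab ⟨ha, hb⟩)
      exact hz0 (h0 z hz)
    obtain ⟨z, hz, hW⟩ := hW
    refine Isl.point_pick (hop n) (hD n).comp (hD n).lm_cont (fun z hz => (hD n).lm_pos hz)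
      (hD n).kap_cont hz ?_ n
    exact div_pos (norm_pos_iff.2 hW) (pow_pos ((hD n).lm_pos hz) 3)
  choose q hq hk hpick using hpick
  exact Isl.no_Sq hα (Ω := Ω) (h := h) (g := g) (L := fun n => Isl.kap (h n) (g n) (q n))
    (ε := fun n => 1 / ((n:ℝ) + 1)) (q := q)
    ⟨hD, hk, fun n => by positivity, tendsto_one_div_add_atTop_nhds_zero_nat, hq, fun n => rfl,
      hpick, hno⟩
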